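/- Let 1 ≤ r ≤ n−1 and let S = {q^{−i}d^{j} : i, j ∈ ℕ} ⊆ M_q(n), where d = d_r. Then the image π(S) of S under the quotient map π: M_q(n) → M^{r+1}_q(n) is a (left and right) Ore set consisting of regular elements of M^{r+1}_q(n). -/

import Mathlib

open scoped BigOperators

/-- Defining relations of the quantized matrix algebra `M_q(n,r)` (generators `Z (i,j)`). -/
inductive QMatRel (k : Type) [Field k] (q : k) (n r : ℕ) :
    FreeAlgebra k (Fin n × Fin r) → FreeAlgebra k (Fin n × Fin r) → Prop
  | row (i : Fin n) (j l : Fin r) (h : j < l) :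
      QMatRel k q n r (FreeAlgebra.ι k (i, j) * FreeAlgebra.ι k (i, l))
        (q • (FreeAlgebra.ι k (i, l) * FreeAlgebra.ι k (i, j)))
  | col (i s : Fin n) (j : Fin r) (h : i < s) :
      QMatRel k q n r (FreeAlgebra.ι k (i, j) * FreeAlgebra.ι k (s, j))
        (q • (FreeAlgebra.ι k (s, j) * FreeAlgebra.ι k (i, j)))
  | cross (i s : Fin n) (j l : Fin r) (h1 : i < s) (h2 : l < j) :
      QMatRel k q n r (FreeAlgebra.ι k (i, j) * FreeAlgebra.ι k (s, l))
        (FreeAlgebra.ι k (s, l) * FreeAlgebra.ι k (i, j))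
  | diag (i s : Fin n) (j l : Fin r) (h1 : i < s) (h2 : j < l) :
      QMatRel k q n r (FreeAlgebra.ι k (i, j) * FreeAlgebra.ι k (s, l))
        (FreeAlgebra.ι k (s, l) * FreeAlgebra.ι k (i, j) +
          (q - q⁻¹) • (FreeAlgebra.ι k (i, l) * FreeAlgebra.ι k (s, j)))

/-- The quantized matrix algebra `M_q(n,r)`. -/
abbrev QMat (k : Type) [Field k] (q : k) (n r : ℕ) : Type := RingQuot (QMatRel k q n r)

/-- The generator `Z_{i,j}` of `M_q(n,r)`. -/
noncomputable def Zgen (k : Type) [Field k] (q : k) (n r : ℕ) (i : Fin n) (j : Fin r) :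
    QMat k q n r :=
  RingQuot.mkAlgHom k (QMatRel k q n r) (FreeAlgebra.ι k (i, j))

/-- Number of inversions (the length) of a permutation. -/
def invCount {t : ℕ} (σ : Equiv.Perm (Fin t)) : ℕ :=
  (Finset.univ.filter (fun p : Fin t × Fin t => p.1 < p.2 ∧ σ p.2 < σ p.1)).card

/-- The `t × t` quantum minor on rows `row 0 < ... < row (t-1)` and columns
`col 0 < ... < col (t-1)`. -/
noncomputable def qMinor (k : Type) [Field k] (q : k) (n r : ℕ) (t : ℕ)
    (row : Fin t → Fin n) (col : Fin t → Fin r) : QMat k q n r :=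
  ∑ σ : Equiv.Perm (Fin t),
    ((-q) ^ invCount σ) • (List.ofFn fun a => Zgen k q n r (row a) (col (σ a))).prod


/-- The set of all `t × t` quantum minors of `M_q(n)` (rows `ro 0 < ... < ro (t-1)`,
columns `co 0 < ... < co (t-1)`). -/
def minorSet (k : Type) [Field k] (q : k) (n t : ℕ) : Set (QMat k q n n) :=
  {x | ∃ ro co : Fin t → Fin n, StrictMono ro ∧ StrictMono co ∧ x = qMinor k q n n t ro co}

/-- The relation identifying every `t × t` quantum minor of `M_q(n)` with `0`; the
corresponding `RingQuot` is the quotient of `M_q(n)` by the two-sided ideal `I^t_q`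
generated by all `t × t` quantum minors. -/
def minorRel (k : Type) [Field k] (q : k) (n t : ℕ) :
    QMat k q n n → QMat k q n n → Prop :=
  fun a b => a ∈ minorSet k q n t ∧ b = 0

/-- The quantized function algebra `M^{r+1}_q(n) = M_q(n) / I^{r+1}_q` of rank `r`
matrices. -/
abbrev QMatRank (k : Type) [Field k] (q : k) (n r : ℕ) : Type :=
  RingQuot (minorRel k q n (r + 1))

/-- The quotient map `π : M_q(n) → M^{r+1}_q(n)`. -/
noncomputable def rankProj (k : Type) [Field k] (q : k) (n r : ℕ) :
    QMat k q n n →ₐ[k] QMatRank k q n r :=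
  RingQuot.mkAlgHom k (minorRel k q n (r + 1))

/-- The quantum minor `d = d_r`: the `r × r` quantum minor of `M_q(n)` on rows and
columns `1, ..., r`. -/
noncomputable def dMinor (k : Type) [Field k] (q : k) (n r : ℕ) (h : r ≤ n) :
    QMat k q n n :=
  qMinor k q n n r (fun a => Fin.castLE h a) (fun a => Fin.castLE h a)

/-- `q` is either generic (not a root of unity) or a primitive `m`-th root of unity for
some `m ≥ 1`. -/
def GenericOrRootOfUnity (k : Type) [Field k] (q : k) : Prop :=
  (∀ m : ℕ, 0 < m → q ^ m ≠ 1) ∨ ∃ m : ℕ, 0 < m ∧ IsPrimitiveRoot q m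

/-- The set `S = {q^{-i} d^j : i, j ∈ ℕ}` in `M_q(n)`, where `d = d_r`. -/
def powerSet (k : Type) [Field k] (q : k) (n r : ℕ) (h : r ≤ n) : Set (QMat k q n n) :=
  {x | ∃ i j : ℕ, x = (q⁻¹) ^ i • dMinor k q n r h ^ j}

section QuantumMatrices

variable {k : Type} [Field k] {B : Type} [Ring B] [Algebra k B]

/-- A family of elements of a `k`-algebra satisfying the relations of a quantum matrix. -/
structure IsQMat (q : k) {ι κ : Type} [LinearOrder ι] [LinearOrder κ] (Z : ι → κ → B) :
    Prop where
  row : ∀ i j l, j < l → Z i j * Z i l = q • (Z i l * Z i j)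
  col : ∀ i s j, i < s → Z i j * Z s j = q • (Z s j * Z i j)
  cross : ∀ i s j l, i < s → l < j → Z i j * Z s l = Z s l * Z i j
  diag : ∀ i s j l, i < s → j < l →
    Z i j * Z s l = Z s l * Z i j + (q - q⁻¹) • (Z i l * Z s j)

/-- Diagonal coefficient of the `R`-matrix. -/
def rDiag (q : k) {ι : Type} [LinearOrder ι] (i s : ι) : k := if i = s then q else 1

/-- Off-diagonal coefficient of the `R`-matrix. -/
def rOff (q : k) {ι : Type} [LinearOrder ι] (i s : ι) : k := if s < i then q - q⁻¹ else 0

variable {q : k} {ι κ μ : Type} [LinearOrder ι] [LinearOrder κ] [LinearOrder μ]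

/-- The relations of a quantum matrix imply the `RTT` relation. -/
theorem IsQMat.rtt (hq : q ≠ 0) {Z : ι → κ → B} (h : IsQMat q Z) (i s : ι) (j t : κ) :
    rDiag q i s • (Z i j * Z s t) + rOff q i s • (Z s j * Z i t) =
      rDiag q j t • (Z s t * Z i j) + rOff q t j • (Z s j * Z i t) := by
  unfold rDiag rOff
  rcases lt_trichotomy i s with h1 | rfl | h1 <;> rcases lt_trichotomy j t with h2 | rfl | h2
  · simp only [h1.ne, h2.ne, h1.not_gt, h2, if_true, if_false, h.diag i s j t h1 h2,
      h.cross i s t j h1 h2]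
    module
  · simp only [h1.ne, h1.not_gt, lt_irrefl, if_true, if_false, h.col i s j h1]
    module
  · simp only [h1.ne, h2.ne', h1.not_gt, h2.not_gt, if_false, h.cross i s j t h1 h2]
  · simp only [h2.ne, lt_irrefl, h2, if_true, if_false, h.row i j t h2, smul_smul]
    match_scalars
    field_simp
    ring
  · simp
  · simp only [h2.ne', lt_irrefl, h2.not_gt, if_true, if_false, h.row i t j h2]
    module
  · simp only [h1.ne', h2.ne, h1, h2, if_true, if_false, h.cross s i t j h1 h2]
  · simp only [h1.ne', h1, lt_irrefl, if_true, if_false, h.col s i j h1, smul_smul]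
    match_scalars
    field_simp
    ring
  · simp only [h1.ne', h2.ne', h1, h2.not_gt, if_true, if_false, h.diag s i t j h1 h2]
    module

/-- The `RTT` relation implies the relations of a quantum matrix. -/
theorem IsQMat.of_rtt {Z : ι → κ → B}
    (h : ∀ (i s : ι) (j t : κ),
      rDiag q i s • (Z i j * Z s t) + rOff q i s • (Z s j * Z i t) =
        rDiag q j t • (Z s t * Z i j) + rOff q t j • (Z s j * Z i t)) : IsQMat q Z := by
  unfold rDiag rOff at h
  have hcross : ∀ i s j l, i < s → l < j → Z i j * Z s l = Z s l * Z i j := by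
    intro i s j t h1 h2
    have := h i s j t
    simpa [h1.ne, h2.ne', h1.not_gt, h2.not_gt] using this
  refine ⟨?_, ?_, hcross, ?_⟩
  · intro i j l hj
    have := h i i l j
    simpa [hj.ne', hj.not_gt] using this.symm
  · intro i s j hi
    have := h i s j j
    simpa [hi.ne, hi.not_gt] using this
  · intro i s j t h1 h2
    have := h i s j t
    rw [hcross i s t j h1 h2]
    simpa [h1.ne, h2.ne, h1.not_gt, h2] using this

theorem IsQMat.transpose {Z : ι → κ → B} (h : IsQMat q Z) :
    IsQMat q (fun j i => Z i j) where
  row i j l hj := h.col j l i hj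
  col i s j hi := h.row j i s hi
  cross i s j l h1 h2 := (h.cross l j s i h2 h1).symm
  diag i s j l h1 h2 := by
    rw [h.diag j l i s h2 h1, h.cross j l s i h2 h1]

theorem IsQMat.submatrix {Z : ι → κ → B} (h : IsQMat q Z) {ι' κ' : Type} [LinearOrder ι']
    [LinearOrder κ'] {f : ι' → ι} {g : κ' → κ} (hf : StrictMono f) (hg : StrictMono g) :
    IsQMat q (fun i j => Z (f i) (g j)) where
  row _ _ _ hj := h.row _ _ _ (hg hj)
  col _ _ _ hi := h.col _ _ _ (hf hi)
  cross _ _ _ _ h1 h2 := h.cross _ _ _ _ (hf h1) (hg h2)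
  diag _ _ _ _ h1 h2 := h.diag _ _ _ _ (hf h1) (hg h2)

/-- The product of two quantum matrices with mutually commuting entries is a quantum matrix. -/
theorem IsQMat.mul (hq : q ≠ 0) [Fintype κ] {Y : ι → κ → B} {X : κ → μ → B}
    (hY : IsQMat q Y) (hX : IsQMat q X) (hc : ∀ i l m j, Commute (X m j) (Y i l)) :
    IsQMat q (fun i j => ∑ l, Y i l * X l j) := by
  have key : ∀ (i s : ι) (j t : μ), (∑ l, Y i l * X l j) * (∑ m, Y s m * X m t) =
      ∑ l, ∑ m, (Y i l * Y s m) * (X l j * X m t) := by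
    intro i s j t
    rw [Finset.sum_mul_sum]
    refine Finset.sum_congr rfl fun l _ => Finset.sum_congr rfl fun m _ => ?_
    rw [mul_assoc, ← mul_assoc (X l j), (hc s m l j).eq]
    simp only [mul_assoc]
  apply IsQMat.of_rtt
  intro i s j t
  rw [key, key, key]
  calc _ = ∑ l, ∑ m, (rDiag q i s • (Y i l * Y s m) + rOff q i s • (Y s l * Y i m)) *
          (X l j * X m t) := by
        simp only [Finset.smul_sum, ← Finset.sum_add_distrib, add_mul, smul_mul_assoc]
    _ = ∑ l, ∑ m, (rDiag q l m • (Y s m * Y i l) + rOff q m l • (Y s l * Y i m)) *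
          (X l j * X m t) := by
        simp only [hY.rtt hq]
    _ = ∑ l, ∑ m, (Y s m * Y i l) *
          (rDiag q l m • (X l j * X m t) + rOff q l m • (X m j * X l t)) := by
        simp only [add_mul, mul_add, Finset.sum_add_distrib]
        congr 1
        · simp
        · rw [Finset.sum_comm]
          simp
    _ = ∑ l, ∑ m, (Y s m * Y i l) *
          (rDiag q j t • (X m t * X l j) + rOff q t j • (X m j * X l t)) := by
        simp only [hX.rtt hq]
    _ = _ := by
        simp only [mul_add, Finset.sum_add_distrib, Finset.smul_sum, mul_smul_comm]
        congr 1
        · rw [Finset.sum_comm]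
        · rw [Finset.sum_comm]

theorem IsQMat.one : IsQMat q (fun i j : ι => (if i = j then 1 else 0 : B)) where
  row i j l hj := by
    by_cases h : i = j
    · subst h; simp [hj.ne]
    · simp [h]
  col i s j hi := by
    by_cases h : i = j
    · subst h; simp [hi.ne']
    · simp [h]
  cross i s j l h1 h2 := by split_ifs <;> simp
  diag i s j l h1 h2 := by
    have h3 : ((if i = l then 1 else 0 : B)) * (if s = j then 1 else 0) = 0 := by
      by_cases h : i = l
      · rw [if_neg (c := s = j), mul_zero]
        rintro rfl
        subst h
        exact lt_asymm h1 h2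
      · rw [if_neg h, zero_mul]
    rw [h3, smul_zero, add_zero]
    split_ifs <;> simp

end QuantumMatrices

section RowMinors

theorem swap_lt_swap {t : ℕ} {a b x y : Fin t} (hab : b.val = a.val + 1) (hxy : x < y)
    (hne : ¬ (x = a ∧ y = b)) : Equiv.swap a b x < Equiv.swap a b y := by
  simp only [Equiv.swap_apply_def, Fin.lt_def, Fin.ext_iff] at *
  split_ifs <;> omega

/-- Composing with an adjacent transposition at an ascent increases the length by one. -/
theorem invCount_mul_swap {t : ℕ} (σ : Equiv.Perm (Fin t)) {a b : Fin t}
    (hab : b.val = a.val + 1) (h : σ a < σ b) :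
    invCount (σ * Equiv.swap a b) = invCount σ + 1 := by
  have hlt : a < b := by rw [Fin.lt_def]; omega
  unfold invCount
  have : (Finset.univ.filter (fun p : Fin t × Fin t => p.1 < p.2 ∧
      (σ * Equiv.swap a b) p.2 < (σ * Equiv.swap a b) p.1)) =
      insert (a, b) ((Finset.univ.filter (fun p : Fin t × Fin t => p.1 < p.2 ∧
        σ p.2 < σ p.1)).map ((Equiv.swap a b).prodCongr (Equiv.swap a b)).toEmbedding) := by
    ext ⟨x, y⟩
    rw [Finset.mem_insert, Finset.mem_map_equiv, Finset.mem_filter, Finset.mem_filter]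
    simp only [Finset.mem_univ, true_and, Equiv.Perm.mul_apply, Equiv.prodCongr_symm,
      Equiv.prodCongr_apply, Prod.map_apply, Equiv.symm_swap, Prod.mk.injEq]
    by_cases hxy : x = a ∧ y = b
    · obtain ⟨rfl, rfl⟩ := hxy
      simp [hlt, h]
    · simp only [hxy, false_or]
      constructor
      · rintro ⟨h1, h2⟩
        exact ⟨swap_lt_swap hab h1 hxy, h2⟩
      · rintro ⟨h1, h2⟩
        refine ⟨?_, h2⟩
        have h3 : ¬ (Equiv.swap a b x = a ∧ Equiv.swap a b y = b) := by
          rintro ⟨h4, h5⟩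
          rw [h4, h5] at h2
          exact lt_asymm h h2
        simpa using swap_lt_swap hab h1 h3
  rw [this, Finset.card_insert_of_notMem, Finset.card_map]
  rw [Finset.mem_map_equiv, Finset.mem_filter]
  simp only [Equiv.prodCongr_symm, Equiv.prodCongr_apply, Prod.map_apply,
    Equiv.symm_swap, Equiv.swap_apply_left, Equiv.swap_apply_right]
  exact fun h' => absurd h'.2.1 hlt.not_gt

theorem invCount_one {t : ℕ} : invCount (1 : Equiv.Perm (Fin t)) = 0 := by
  unfold invCount
  rw [Finset.card_eq_zero, Finset.filter_eq_empty_iff]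
  rintro ⟨x, y⟩ - ⟨h1, h2⟩
  exact lt_asymm h1 h2

variable {k : Type} [Field k] {B : Type} [Ring B] [Algebra k B]
variable {q : k} {ι κ μ : Type} [LinearOrder ι] [LinearOrder κ] [LinearOrder μ]

/-- The expression defining the quantum minor, for arbitrary rows and columns. -/
def rowMinor (q : k) {ι κ : Type} {t : ℕ} (X : ι → κ → B) (ro : Fin t → ι) (co : Fin t → κ) : B :=
  ∑ σ : Equiv.Perm (Fin t), ((-q) ^ invCount σ) • (List.ofFn fun a => X (ro a) (co (σ a))).prod

theorem prod_ofFn_split {t : ℕ} (g : Fin t → B) {a b : Fin t} (hab : b.val = a.val + 1) :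
    (List.ofFn g).prod =
      ((List.ofFn g).take a).prod * (g a * g b) * ((List.ofFn g).drop (a + 2)).prod := by
  have ha : a.val < (List.ofFn g).length := by simp
  have hb : a.val + 1 < (List.ofFn g).length := by simp [← hab]
  conv_lhs => rw [← List.take_append_drop a.val (List.ofFn g), List.drop_eq_getElem_cons ha,
    List.drop_eq_getElem_cons hb]
  simp only [List.prod_append, List.prod_cons, List.getElem_ofFn, mul_assoc]
  congr 3
  congr 1
  exact Fin.ext hab.symm

theorem take_ofFn_congr {M : Type} {t m : ℕ} {g g' : Fin t → M}
    (h : ∀ x : Fin t, x.val < m → g x = g' x) :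
    (List.ofFn g).take m = (List.ofFn g').take m := by
  apply List.ext_getElem
  · simp
  · intro i h1 h2
    simp only [List.getElem_take, List.getElem_ofFn]
    apply h
    simp at h1
    exact h1.1

theorem drop_ofFn_congr {M : Type} {t m : ℕ} {g g' : Fin t → M}
    (h : ∀ x : Fin t, m ≤ x.val → g x = g' x) :
    (List.ofFn g).drop m = (List.ofFn g').drop m := by
  apply List.ext_getElem
  · simp
  · intro i h1 h2
    simp only [List.getElem_drop, List.getElem_ofFn]
    apply h
    simp

/-- Cancellation in a sum over permutations from cancellation at each adjacent pair. -/
theorem sum_perm_eq_zero {M : Type} [AddCommGroup M] {t : ℕ} (F : Equiv.Perm (Fin t) → M)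
    {a b : Fin t} (hab : b.val = a.val + 1)
    (h : ∀ σ : Equiv.Perm (Fin t), σ a < σ b → F σ + F (σ * Equiv.swap a b) = 0) :
    ∑ σ, F σ = 0 := by
  have hne : a ≠ b := by intro h; rw [h] at hab; omega
  refine Finset.sum_involution (fun σ _ => σ * Equiv.swap a b) ?_ ?_ ?_ ?_
  · intro σ _
    rcases lt_or_gt_of_ne (σ.injective.ne hne) with h1 | h1
    · exact h σ h1
    · have := h (σ * Equiv.swap a b) (by simpa using h1)
      rw [mul_assoc, Equiv.swap_mul_self, mul_one] at this
      rw [add_comm]; exact this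
  · intro σ _ _ h1
    have := congrArg (fun τ : Equiv.Perm (Fin t) => τ a) h1
    simp at this
    exact hne this.symm
  · intros; simp
  · intro σ _; simp [mul_assoc]

theorem rowMinor_term_swap {ι κ : Type} {t : ℕ} (X : ι → κ → B) (ro : Fin t → ι) (co : Fin t → κ)
    {a b : Fin t} (hab : b.val = a.val + 1) (σ : Equiv.Perm (Fin t)) :
    ∃ A C : B, ∀ σ' : Equiv.Perm (Fin t), (σ' = σ ∨ σ' = σ * Equiv.swap a b) →
      ∀ ro' : Fin t → ι, (ro' = ro ∨ ro' = ro ∘ Equiv.swap a b) →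
      (List.ofFn fun x => X (ro' x) (co (σ' x))).prod =
        A * (X (ro' a) (co (σ' a)) * X (ro' b) (co (σ' b))) * C := by
  refine ⟨((List.ofFn fun x => X (ro x) (co (σ x))).take a).prod,
    ((List.ofFn fun x => X (ro x) (co (σ x))).drop (a + 2)).prod, ?_⟩
  intro σ' hσ ro' hro
  rw [prod_ofFn_split _ hab]
  have key : ∀ x : Fin t, x ≠ a → x ≠ b → X (ro' x) (co (σ' x)) = X (ro x) (co (σ x)) := by
    intro x hx hx'
    rcases hσ with rfl | rfl <;> rcases hro with rfl | rfl <;>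
      simp [Equiv.swap_apply_of_ne_of_ne hx hx']
  rw [take_ofFn_congr (g' := fun x => X (ro x) (co (σ x))),
    drop_ofFn_congr (g' := fun x => X (ro x) (co (σ x)))]
  · intro x hx
    apply key <;> rintro rfl <;> omega
  · intro x hx
    apply key <;> rintro rfl <;> omega

theorem rowMinor_eq_zero_of_adjacent {t : ℕ} {X : ι → κ → B} (hX : IsQMat q X)
    {ro : Fin t → ι} {co : Fin t → κ} (hco : StrictMono co) {a b : Fin t}
    (hab : b.val = a.val + 1) (h : ro a = ro b) : rowMinor q X ro co = 0 := by
  refine sum_perm_eq_zero _ hab fun σ hσ => ?_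
  obtain ⟨A, C, hAC⟩ := rowMinor_term_swap X ro co hab σ
  rw [hAC σ (Or.inl rfl) ro (Or.inl rfl), hAC _ (Or.inr rfl) ro (Or.inl rfl),
    invCount_mul_swap σ hab hσ]
  simp only [Equiv.Perm.mul_apply, Equiv.swap_apply_left, Equiv.swap_apply_right, h]
  rw [hX.row (ro b) _ _ (hco hσ), pow_succ]
  simp only [mul_smul_comm, smul_mul_assoc, smul_smul]
  module

theorem rowMinor_swap {t : ℕ} (hq : q ≠ 0) {X : ι → κ → B} (hX : IsQMat q X)
    {ro : Fin t → ι} {co : Fin t → κ} (hco : StrictMono co) {a b : Fin t}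
    (hab : b.val = a.val + 1) (h : ro a < ro b) :
    rowMinor q X (ro ∘ Equiv.swap a b) co = (-q) • rowMinor q X ro co := by
  rw [← sub_eq_zero]
  unfold rowMinor
  rw [Finset.smul_sum, ← Finset.sum_sub_distrib]
  refine sum_perm_eq_zero _ hab fun σ hσ => ?_
  obtain ⟨A, C, hAC⟩ := rowMinor_term_swap X ro co hab σ
  rw [hAC σ (Or.inl rfl) ro (Or.inl rfl), hAC _ (Or.inr rfl) ro (Or.inl rfl),
    hAC σ (Or.inl rfl) _ (Or.inr rfl), hAC _ (Or.inr rfl) _ (Or.inr rfl),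
    invCount_mul_swap σ hab hσ]
  simp only [Equiv.Perm.mul_apply, Equiv.swap_apply_left, Equiv.swap_apply_right,
    Function.comp_apply]
  rw [hX.diag _ _ _ _ h (hco hσ), hX.cross _ _ _ _ h (hco hσ), pow_succ]
  simp only [mul_smul_comm, smul_mul_assoc, smul_smul, mul_add, add_mul]
  match_scalars <;> field_simp <;> ring

/-- A row minor with a repeated row vanishes. -/
theorem rowMinor_eq_zero_of_not_injective {t : ℕ} (hq : q ≠ 0) {X : ι → κ → B}
    (hX : IsQMat q X) {ro : Fin t → ι} {co : Fin t → κ} (hco : StrictMono co)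
    (h : ¬ Function.Injective ro) : rowMinor q X ro co = 0 := by
  have key : ∀ (m : ℕ) (ro : Fin t → ι) (i j : Fin t), j.val = i.val + m + 1 → ro i = ro j →
      rowMinor q X ro co = 0 := by
    intro m
    induction m with
    | zero => exact fun ro i j hij hr => rowMinor_eq_zero_of_adjacent hX hco hij hr
    | succ m ih =>
      intro ro i j hij hr
      have hi : i.val + 1 < t := by omega
      set i' : Fin t := ⟨i.val + 1, hi⟩ with hi'
      have hii : i'.val = i.val + 1 := rfl
      have hji : j ≠ i := by rintro rfl; omega
      have hji' : j ≠ i' := by rintro rfl; omega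
      have h0 : rowMinor q X (ro ∘ Equiv.swap i i') co = 0 := by
        apply ih _ i' j (by omega)
        simp [Equiv.swap_apply_of_ne_of_ne hji hji', hr]
      rcases lt_trichotomy (ro i) (ro i') with h1 | h1 | h1
      · rw [rowMinor_swap hq hX hco hii h1] at h0
        exact (smul_eq_zero_iff_right (neg_ne_zero.mpr hq)).mp h0
      · exact rowMinor_eq_zero_of_adjacent hX hco hii h1
      · have h2 := rowMinor_swap hq hX (ro := ro ∘ Equiv.swap i i') hco hii (by simpa using h1)
        rw [h0, smul_zero] at h2
        rw [← h2]
        congr 1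
        ext x
        simp
  simp only [Function.Injective, not_forall] at h
  obtain ⟨i, j, hr, hij⟩ := h
  rcases lt_or_gt_of_ne hij with h1 | h1
  · exact key (j.val - i.val - 1) ro i j (by rw [Fin.lt_def] at h1; omega) hr
  · exact key (i.val - j.val - 1) ro j i (by rw [Fin.lt_def] at h1; omega) hr.symm

/-- Noncommutative expansion of a product of sums. -/
theorem prod_ofFn_sum {τ : Type} [Fintype τ] : ∀ {t : ℕ} (u : Fin t → τ → B),
    (List.ofFn fun a => ∑ l, u a l).prod =
      ∑ f : Fin t → τ, (List.ofFn fun a => u a (f a)).prod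
  | 0, u => by simp
  | t + 1, u => by
    rw [List.ofFn_succ, List.prod_cons, prod_ofFn_sum (fun a : Fin t => u a.succ),
      Finset.sum_mul_sum, ← (Fin.consEquiv fun _ : Fin (t + 1) => τ).sum_comp,
      Fintype.sum_prod_type]
    simp [Fin.consEquiv, List.ofFn_succ]

theorem commute_prod_ofFn {t : ℕ} {z : B} {x : Fin t → B} (h : ∀ a, Commute z (x a)) :
    Commute z (List.ofFn x).prod := by
  apply Commute.list_prod_right
  simpa [List.mem_ofFn] using h

theorem prod_ofFn_mul : ∀ {t : ℕ} {y x : Fin t → B} (_ : ∀ a b, Commute (x a) (y b)),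
    (List.ofFn fun a => y a * x a).prod = (List.ofFn y).prod * (List.ofFn x).prod
  | 0, _, _, _ => by simp
  | t + 1, y, x, h => by
    simp only [List.ofFn_succ, List.prod_cons]
    rw [prod_ofFn_mul (fun a b => h a.succ b.succ)]
    have : Commute (x 0) (List.ofFn fun a : Fin t => y a.succ).prod :=
      commute_prod_ofFn fun a => h 0 a.succ
    rw [mul_assoc, ← mul_assoc (x 0), this.eq]
    simp only [mul_assoc]

/-- Expansion of a minor of a product of quantum matrices along the rows of the first factor. -/
theorem rowMinor_mul {ι κ μ : Type} [Fintype κ] {t : ℕ} {Y : ι → κ → B} {X : κ → μ → B}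
    (hc : ∀ i l m j, Commute (X m j) (Y i l)) (ro : Fin t → ι) (co : Fin t → μ) :
    rowMinor q (fun i j => ∑ l, Y i l * X l j) ro co =
      ∑ f : Fin t → κ, (List.ofFn fun a => Y (ro a) (f a)).prod * rowMinor q X f co := by
  unfold rowMinor
  simp only [prod_ofFn_sum, Finset.mul_sum, Finset.smul_sum]
  rw [Finset.sum_comm]
  refine Finset.sum_congr rfl fun f _ => Finset.sum_congr rfl fun σ _ => ?_
  rw [prod_ofFn_mul fun a b => hc _ _ _ _, mul_smul_comm]

/-- Minors of size larger than the inner dimension vanish. -/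
theorem rowMinor_mul_eq_zero {ι : Type} {t r : ℕ} (hq : q ≠ 0) (hrt : r < t) {Y : ι → Fin r → B}
    {X : Fin r → μ → B} (hX : IsQMat q X) (hc : ∀ i l m j, Commute (X m j) (Y i l))
    (ro : Fin t → ι) {co : Fin t → μ} (hco : StrictMono co) :
    rowMinor q (fun i j => ∑ l, Y i l * X l j) ro co = 0 := by
  rw [rowMinor_mul hc]
  refine Finset.sum_eq_zero fun f _ => ?_
  rw [rowMinor_eq_zero_of_not_injective hq hX hco, mul_zero]
  intro hf
  have := Fintype.card_le_of_injective f hf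
  simp at this
  omega

theorem eq_id_of_injective_of_le {t : ℕ} {f : Fin t → Fin t} (hf : Function.Injective f)
    (h : ∀ a, f a ≤ a) : f = id := by
  have : ∀ (m : ℕ) (a : Fin t), a.val = m → f a = a := by
    intro m
    induction m using Nat.strong_induction_on with
    | _ m ih =>
      intro a ha
      by_contra hne
      have hlt : f a < a := lt_of_le_of_ne (h a) hne
      have h1 := ih (f a).val (by rw [← ha]; exact hlt) (f a) rfl
      exact hne (hf h1)
  exact funext fun a => this a a rfl

theorem prod_ofFn_eq_zero {t : ℕ} {x : Fin t → B} {a : Fin t} (h : x a = 0) :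
    (List.ofFn x).prod = 0 := by
  obtain ⟨s, u, hs⟩ := List.append_of_mem (List.mem_ofFn.mpr ⟨a, h⟩ : (0 : B) ∈ List.ofFn x)
  rw [hs]
  simp

/-- The leading principal minor of a product of a lower and an upper trapezoidal quantum
matrix. -/
theorem rowMinor_mul_triangular {n r : ℕ} (hq : q ≠ 0) (hrn : r ≤ n) {Y : Fin n → Fin r → B}
    {X : Fin r → Fin n → B} (hX : IsQMat q X) (hc : ∀ i l m j, Commute (X m j) (Y i l))
    (hY0 : ∀ i l, i.val < l.val → Y i l = 0) (hX0 : ∀ l j, j.val < l.val → X l j = 0) :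
    rowMinor q (fun i j => ∑ l, Y i l * X l j) (Fin.castLE hrn) (Fin.castLE hrn) =
      (List.ofFn fun a : Fin r => Y (Fin.castLE hrn a) a).prod *
        (List.ofFn fun a : Fin r => X a (Fin.castLE hrn a)).prod := by
  rw [rowMinor_mul hc, Finset.sum_eq_single id]
  · congr 1
    unfold rowMinor
    rw [Finset.sum_eq_single 1]
    · simp [invCount_one]
    · intro σ _ hσ
      have : ∃ a, σ a < a := by
        by_contra! hcon
        apply hσ
        have h1 := eq_id_of_injective_of_le (σ⁻¹).injective
          (fun a => by simpa using hcon (σ⁻¹ a))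
        have h2 : σ⁻¹ = 1 := Equiv.ext fun x => congrFun h1 x
        simpa using h2
      obtain ⟨a, ha⟩ := this
      rw [prod_ofFn_eq_zero (a := a) (hX0 _ _ ha), smul_zero]
    · simp
  · intro f _ hf
    by_cases hinj : Function.Injective f
    · have : ∃ a, a < f a := by
        by_contra! hcon
        exact hf (eq_id_of_injective_of_le hinj hcon)
      obtain ⟨a, ha⟩ := this
      rw [prod_ofFn_eq_zero (x := fun a => Y (Fin.castLE hrn a) (f a)) (a := a)
        (hY0 _ _ ha), zero_mul]
    · rw [rowMinor_eq_zero_of_not_injective hq hX (Fin.strictMono_castLE hrn) hinj, mul_zero]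
  · simp

theorem prod_ofFn_mul_eq_smul : ∀ {t : ℕ} {x : Fin t → B} {z : B} {c : Fin t → k}
    (_ : ∀ a, x a * z = c a • (z * x a)),
    (List.ofFn x).prod * z = (∏ a, c a) • (z * (List.ofFn x).prod)
  | 0, _, _, _, _ => by simp
  | t + 1, x, z, c, h => by
    simp only [List.ofFn_succ, List.prod_cons]
    rw [mul_assoc, prod_ofFn_mul_eq_smul (fun a : Fin t => h a.succ), mul_smul_comm, ← mul_assoc,
      h 0, smul_mul_assoc, smul_smul, Fin.prod_univ_succ, mul_comm (c 0), mul_assoc]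

/-- The product of the diagonal entries of a lower trapezoidal quantum matrix `q`-commutes with
every entry. -/
theorem diagProd_mul {n r : ℕ} (hq : q ≠ 0) (hrn : r ≤ n) {Y : Fin n → Fin r → B}
    (hY : IsQMat q Y) (hY0 : ∀ i l, i.val < l.val → Y i l = 0) (i : Fin n) (l : Fin r) :
    (List.ofFn fun a : Fin r => Y (Fin.castLE hrn a) a).prod * Y i l =
      (if i.val < r then 1 else q) •
        (Y i l * (List.ofFn fun a : Fin r => Y (Fin.castLE hrn a) a).prod) := by
  rcases lt_or_ge i.val l.val with hil | hil
  · simp [hY0 i l hil]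
  have key : ∀ a : Fin r, Y (Fin.castLE hrn a) a * Y i l =
      ((if a = l then q else 1) * (if a.val = i.val then q⁻¹ else 1)) •
        (Y i l * Y (Fin.castLE hrn a) a) := by
    intro a
    rcases lt_trichotomy a.val i.val with h1 | h1 | h1
    · rw [if_neg h1.ne]
      have h1' : Fin.castLE hrn a < i := h1
      rcases lt_trichotomy a l with h2 | h2 | h2
      · rw [if_neg h2.ne, hY.diag _ _ _ _ h1' h2, hY0 (Fin.castLE hrn a) l h2]
        simp
      · subst h2
        rw [if_pos rfl, hY.col _ _ _ h1', mul_one]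
      · rw [if_neg h2.ne', hY.cross _ _ _ _ h1' h2]
        simp
    · have hi : i = Fin.castLE hrn a := Fin.ext h1.symm
      rw [if_pos h1]
      rcases lt_trichotomy a l with h2 | h2 | h2
      · exact absurd (Fin.lt_def.mp h2) (by omega)
      · subst h2
        rw [if_pos rfl, mul_inv_cancel₀ hq, hi, one_smul]
      · rw [if_neg h2.ne', hi, hY.row _ _ _ h2, smul_smul, one_mul, inv_mul_cancel₀ hq, one_smul]
    · have h1' : i < Fin.castLE hrn a := h1
      have h2 : l < a := by rw [Fin.lt_def]; omega
      rw [if_neg h2.ne', if_neg h1.ne', hY.diag _ _ _ _ h1' h2, hY0 i a h1]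
      simp
  rw [prod_ofFn_mul_eq_smul key, Finset.prod_mul_distrib]
  congr 1
  rw [Finset.prod_ite_eq' Finset.univ l (fun _ => q), if_pos (Finset.mem_univ _)]
  split_ifs with hir
  · have : ∀ a : Fin r, (if a.val = i.val then q⁻¹ else 1) =
        if a = (⟨i.val, hir⟩ : Fin r) then q⁻¹ else 1 := by
      intro a; simp [Fin.ext_iff]
    simp only [this]
    rw [Finset.prod_ite_eq' Finset.univ _ (fun _ => q⁻¹), if_pos (Finset.mem_univ _),
      mul_inv_cancel₀ hq]
  · rw [Finset.prod_eq_one, mul_one]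
    intro a _
    rw [if_neg]
    omega

end RowMinors

section MonomialOperators

variable {k : Type} [Field k] {q : k} {Γ : Type} [AddCommGroup Γ]

/-- The monomial operator sending the basis vector `e_u` to `q ^ χ(u) e_{u + v}`. -/
noncomputable def mono (q : k) (v : Γ) (χ : Γ →+ ℤ) : Module.End k (Γ →₀ k) :=
  Finsupp.linearCombination k fun u => Finsupp.single (u + v) (q ^ χ u)

theorem mono_single (v : Γ) (χ : Γ →+ ℤ) (u : Γ) (c : k) :
    mono q v χ (Finsupp.single u c) = Finsupp.single (u + v) (c * q ^ χ u) := by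
  simp [mono, Finsupp.linearCombination_single]

theorem mono_mul (hq : q ≠ 0) (v v' : Γ) (χ χ' : Γ →+ ℤ) :
    mono q v χ * mono q v' χ' = (q ^ χ v') • mono q (v + v') (χ + χ') := by
  apply Finsupp.lhom_ext
  intro u c
  simp only [Module.End.mul_apply, LinearMap.smul_apply, mono_single, Finsupp.smul_single,
    map_add, AddMonoidHom.add_apply, zpow_add₀ hq, smul_eq_mul]
  congr 1
  · abel
  · ring

theorem mono_zero : mono q (0 : Γ) 0 = 1 := by
  apply Finsupp.lhom_ext
  intro u c
  simp [mono_single]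

theorem mono_mul_comm (hq : q ≠ 0) (v v' : Γ) (χ χ' : Γ →+ ℤ) :
    mono q v χ * mono q v' χ' = (q ^ (χ v' - χ' v)) • (mono q v' χ' * mono q v χ) := by
  rw [mono_mul hq, mono_mul hq, smul_smul, ← zpow_add₀ hq, add_comm v' v, add_comm χ' χ,
    sub_add_cancel]

theorem mono_commute (hq : q ≠ 0) {v v' : Γ} {χ χ' : Γ →+ ℤ} (h : χ v' = 0) (h' : χ' v = 0) :
    Commute (mono q v χ) (mono q v' χ') := by
  have := mono_mul_comm hq v v' χ χ'
  rwa [h, h', sub_zero, zpow_zero, one_smul] at this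

theorem isUnit_mono (hq : q ≠ 0) (v : Γ) (χ : Γ →+ ℤ) : IsUnit (mono q v χ) := by
  have h1 : mono q v χ * (q ^ χ v • mono q (-v) (-χ)) = 1 := by
    rw [mul_smul_comm, mono_mul hq, smul_smul, ← zpow_add₀ hq, map_neg, add_neg_cancel, zpow_zero,
      one_smul, add_neg_cancel, add_neg_cancel, mono_zero]
  have h2 : (q ^ χ v • mono q (-v) (-χ)) * mono q v χ = 1 := by
    rw [smul_mul_assoc, mono_mul hq, smul_smul, ← zpow_add₀ hq, AddMonoidHom.neg_apply,
      add_neg_cancel, zpow_zero, one_smul, neg_add_cancel, neg_add_cancel, mono_zero]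
  exact ⟨⟨_, _, h1, h2⟩, rfl⟩

end MonomialOperators

section Factorization

/-- Index set for the coordinates of exponent vectors. -/
abbrev Expo : Type := (ℕ × ℕ × ℕ) →₀ ℤ

/-- The exponent vector supported on the interval `(j, i]` in block `(b, l)`. -/
noncomputable def vint (b l j i : ℕ) : Expo :=
  ∑ s ∈ Finset.Ioc j i, Finsupp.single (b, l, s) 1

theorem vint_apply (b l j i b' l' s : ℕ) :
    vint b l j i (b', l', s) = if b' = b ∧ l' = l ∧ j < s ∧ s ≤ i then 1 else 0 := by
  unfold vint
  rw [Finsupp.finsetSum_apply]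
  simp only [Finsupp.single_apply, Prod.mk.injEq]
  by_cases h : b = b' ∧ l = l'
  · obtain ⟨rfl, rfl⟩ := h
    simp
  · rw [Finset.sum_eq_zero, if_neg]
    · rintro ⟨h1, h2, -⟩; exact h ⟨h1.symm, h2.symm⟩
    · intro x _
      rw [if_neg]
      rintro ⟨h1, h2, -⟩; exact h ⟨h1, h2⟩

/-- The character used for the entries of the elementary quantum matrices. -/
noncomputable def vchar (b l j i : ℕ) : Expo →+ ℤ :=
  Finsupp.applyAddHom (b, l, i + 1) - Finsupp.applyAddHom (b, l, j)

theorem vchar_apply (b l j i : ℕ) (u : Expo) :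
    vchar b l j i u = u (b, l, i + 1) - u (b, l, j) := rfl

variable {k : Type} [Field k] {q : k}

open Classical in
/-- Entries of the elementary lower triangular quantum matrix of level `l` in block `b`. -/
noncomputable def elemMat (q : k) (b l i j : ℕ) : Module.End k (Expo →₀ k) :=
  if j ≤ i ∧ (i = j ∨ l ≤ j) then mono q (vint b l j i) (vchar b l j i) else 0

theorem elemMat_pos {b l i j : ℕ} (h : j ≤ i ∧ (i = j ∨ l ≤ j)) :
    elemMat q b l i j = mono q (vint b l j i) (vchar b l j i) := if_pos h

theorem elemMat_neg {b l i j : ℕ} (h : ¬ (j ≤ i ∧ (i = j ∨ l ≤ j))) :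
    elemMat q b l i j = 0 := if_neg h

theorem elemMat_mul_comm (hq : q ≠ 0) {b l i j s t : ℕ} (_ : j ≤ i) (_ : t ≤ s) :
    elemMat q b l i j * elemMat q b l s t =
      (q ^ (((if t ≤ i ∧ i < s then 1 else 0) - (if t < j ∧ j ≤ s then 1 else 0)) -
        ((if j ≤ s ∧ s < i then 1 else 0) - (if j < t ∧ t ≤ i then 1 else 0)) : ℤ)) •
        (elemMat q b l s t * elemMat q b l i j) := by
  by_cases h1 : j ≤ i ∧ (i = j ∨ l ≤ j)
  · by_cases h2 : t ≤ s ∧ (s = t ∨ l ≤ t)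
    · rw [elemMat_pos h1, elemMat_pos h2, mono_mul_comm hq]
      congr 2
      simp only [vchar_apply, vint_apply, true_and, Nat.lt_succ_iff, Nat.succ_le_iff]
    · rw [elemMat_neg h2]; simp
  · rw [elemMat_neg h1]; simp

theorem elemMat_isQMat (hq : q ≠ 0) (b l : ℕ) : IsQMat q (elemMat q b l) where
  row i j t h := by
    by_cases h1 : t ≤ i
    · rw [elemMat_mul_comm hq (by omega) h1]
      congr 1
      rw [← zpow_one q, ← zpow_mul]
      congr 1
      split_ifs <;> omega
    · rw [elemMat_neg (j := t) (by omega)]; simp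
  col i s j h := by
    by_cases h1 : j ≤ i
    · rw [elemMat_mul_comm hq h1 (by omega)]
      congr 1
      rw [← zpow_one q, ← zpow_mul]
      congr 1
      split_ifs <;> omega
    · rw [elemMat_neg (i := i) (by omega)]; simp
  cross i s j t h1 h2 := by
    by_cases h3 : j ≤ i
    · rw [elemMat_mul_comm hq h3 (by omega)]
      conv_rhs => rw [← one_smul k (elemMat q b l s t * elemMat q b l i j), ← zpow_zero q]
      congr 2
      split_ifs <;> omega
    · rw [elemMat_neg (i := i) (by omega)]; simp
  diag i s j t h1 h2 := by
    rcases lt_or_ge i t with h3 | h3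
    · rw [elemMat_neg (i := i) (j := t) (by omega), zero_mul, smul_zero, add_zero]
      by_cases h4 : j ≤ i ∧ t ≤ s
      · rw [elemMat_mul_comm hq h4.1 h4.2]
        conv_rhs => rw [← one_smul k (elemMat q b l s t * elemMat q b l i j), ← zpow_zero q]
        congr 2
        split_ifs <;> omega
      · by_cases h5 : j ≤ i
        · rw [elemMat_neg (i := s) (j := t) (by omega)]; simp
        · rw [elemMat_neg (i := i) (j := j) (by omega)]; simp
    · rcases lt_or_ge j l with h4 | h4
      · rw [elemMat_neg (i := i) (j := j) (by omega), elemMat_neg (i := s) (j := j) (by omega)]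
        simp
      · rw [elemMat_pos (i := i) (j := j) (by omega), elemMat_pos (i := s) (j := j) (by omega),
          elemMat_pos (i := i) (j := t) (by omega), elemMat_pos (i := s) (j := t) (by omega),
          mono_mul hq, mono_mul hq, mono_mul hq]
        have e1 : vint b l j i + vint b l t s = vint b l t i + vint b l j s := by
          ext ⟨b', l', s'⟩
          simp only [Finsupp.add_apply, vint_apply]
          split_ifs <;> omega
        have e2 : vchar b l j i + vchar b l t s = vchar b l t i + vchar b l j s := by
          unfold vchar; abel
        have e3 : vchar b l j i (vint b l t s) = 1 := by
          simp only [vchar_apply, vint_apply, true_and]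
          split_ifs <;> omega
        have e4 : vchar b l t s (vint b l j i) = -1 := by
          simp only [vchar_apply, vint_apply, true_and]
          split_ifs <;> omega
        have e5 : vchar b l t i (vint b l j s) = 0 := by
          simp only [vchar_apply, vint_apply, true_and]
          split_ifs <;> omega
        rw [e3, e4, e5, add_comm (vint b l t s), add_comm (vchar b l t s), e1, e2, smul_smul,
          ← add_smul]
        congr 1
        simp

theorem elemMat_commute (hq : q ≠ 0) {b l b' l' : ℕ} (h : (b, l) ≠ (b', l')) (i j s t : ℕ) :
    Commute (elemMat q b l i j) (elemMat q b' l' s t) := by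
  unfold elemMat
  split_ifs
  · apply mono_commute hq
    · simp only [vchar_apply, vint_apply]
      rw [if_neg, if_neg, sub_zero] <;> rintro ⟨rfl, rfl, -⟩ <;> exact h rfl
    · simp only [vchar_apply, vint_apply]
      rw [if_neg, if_neg, sub_zero] <;> rintro ⟨rfl, rfl, -⟩ <;> exact h rfl
  · exact Commute.zero_right _
  · exact Commute.zero_left _
  · exact Commute.zero_left _

/-- The product of the elementary quantum matrices of levels `l, ..., l + m - 1`. -/
noncomputable def prodMat (q : k) (n b : ℕ) : ℕ → ℕ → Fin n → Fin n → Module.End k (Expo →₀ k)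
  | 0, _ => fun i j => if i = j then 1 else 0
  | m + 1, l => fun i j => ∑ s : Fin n, elemMat q b l i s * prodMat q n b m (l + 1) s j

theorem prodMat_succ (n b m l : ℕ) (i j : Fin n) : prodMat q n b (m + 1) l i j =
    ∑ s : Fin n, elemMat q b l i s * prodMat q n b m (l + 1) s j := rfl

theorem commute_prodMat {T : Module.End k (Expo →₀ k)} {n b : ℕ} {m l : ℕ}
    (h : ∀ l', l ≤ l' → ∀ i j, Commute T (elemMat q b l' i j)) (i j : Fin n) :
    Commute T (prodMat q n b m l i j) := by
  induction m generalizing l i with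
  | zero =>
    unfold prodMat
    split_ifs
    · exact Commute.one_right _
    · exact Commute.zero_right _
  | succ m ih =>
    rw [prodMat_succ]
    exact Commute.sum_right _ _ _ fun s _ => (h l le_rfl _ _).mul_right
      (ih (fun l' hl' => h l' (by omega)) _)

theorem prodMat_isQMat (hq : q ≠ 0) (n b m l : ℕ) : IsQMat q (prodMat q n b m l) := by
  induction m generalizing l with
  | zero => exact IsQMat.one
  | succ m ih =>
    have h1 := (elemMat_isQMat hq b l).submatrix (Fin.val_strictMono (n := n))
      (Fin.val_strictMono (n := n))
    refine h1.mul hq (ih (l + 1)) fun i s t j => ?_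
    refine (commute_prodMat (fun l' hl' i' j' => elemMat_commute hq ?_ _ _ _ _) _ _).symm
    simp only [ne_eq, Prod.mk.injEq, true_and]
    omega

theorem prodMat_commute (hq : q ≠ 0) {b b' : ℕ} (hb : b ≠ b') (n m l m' l' : ℕ)
    (i j s t : Fin n) : Commute (prodMat q n b m l i j) (prodMat q n b' m' l' s t) := by
  refine commute_prodMat (fun c _ i' j' => (commute_prodMat (fun c' _ s' t' => ?_) _ _).symm) _ _
  exact elemMat_commute hq (by simp [hb.symm]) _ _ _ _

theorem prodMat_eq_zero_of_lt {n b m l : ℕ} {i j : Fin n} (h : i < j) :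
    prodMat q n b m l i j = 0 := by
  induction m generalizing l i with
  | zero => exact if_neg h.ne
  | succ m ih =>
    rw [prodMat_succ]
    refine Finset.sum_eq_zero fun s _ => ?_
    rcases lt_or_ge s j with hs | hs
    · rw [ih hs, mul_zero]
    · rw [elemMat_neg, zero_mul]
      rw [Fin.lt_def] at h
      rw [Fin.le_def] at hs
      omega

theorem prodMat_eq_zero_of_col_lt {n b m l : ℕ} {i j : Fin n} (hj : j.val < l) (h : i ≠ j) :
    prodMat q n b m l i j = 0 := by
  induction m generalizing l i with
  | zero => exact if_neg h
  | succ m ih =>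
    rw [prodMat_succ]
    refine Finset.sum_eq_zero fun s _ => ?_
    by_cases hs : s = j
    · rw [elemMat_neg, zero_mul]
      subst hs
      have : i.val ≠ s.val := fun h' => h (Fin.ext h')
      omega
    · rw [ih (by omega) hs, mul_zero]

theorem prodMat_diag (hq : q ≠ 0) (n b m l : ℕ) (i : Fin n) :
    ∃ χ, prodMat q n b m l i i = mono q 0 χ := by
  induction m generalizing l with
  | zero => exact ⟨0, by rw [mono_zero]; exact if_pos rfl⟩
  | succ m ih =>
    obtain ⟨χ, hχ⟩ := ih (l + 1)
    refine ⟨vchar b l i i + χ, ?_⟩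
    rw [prodMat_succ, Finset.sum_eq_single i, hχ, elemMat_pos ⟨le_rfl, Or.inl rfl⟩, mono_mul hq]
    · simp [vint]
    · intro s _ hs
      rcases lt_or_gt_of_ne hs with h | h
      · rw [prodMat_eq_zero_of_lt h, mul_zero]
      · rw [elemMat_neg, zero_mul]
        rw [Fin.lt_def] at h
        omega
    · simp

theorem IsQMat.mul_col {B : Type} [Ring B] [Algebra k B] {ι κ : Type} [LinearOrder ι]
    [LinearOrder κ] {Z : ι → κ → B} (hZ : IsQMat q Z) {t : κ → B}
    (htt : ∀ l m, Commute (t l) (t m)) (ht : ∀ l i j, Commute (t l) (Z i j)) :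
    IsQMat q (fun i j => Z i j * t j) := by
  have key : ∀ i j s l, (Z i j * t j) * (Z s l * t l) = (Z i j * Z s l) * (t j * t l) := by
    intro i j s l
    rw [mul_assoc, ← mul_assoc (t j), (ht j s l).eq]
    simp only [mul_assoc]
  refine ⟨fun i j l h => ?_, fun i s j h => ?_, fun i s j l h1 h2 => ?_, fun i s j l h1 h2 => ?_⟩
  · rw [key, key, hZ.row i j l h, (htt l j).eq, smul_mul_assoc]
  · rw [key, key, hZ.col i s j h, smul_mul_assoc]
  · rw [key, key, hZ.cross i s j l h1 h2, (htt l j).eq]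
  · rw [key, key, key, hZ.diag i s j l h1 h2, (htt l j).eq, add_mul, smul_mul_assoc]

/-- Central scaling operators attached to the inner index. -/
noncomputable def midOp (q : k) (l : ℕ) : Module.End k (Expo →₀ k) :=
  mono q (Finsupp.single (2, l, 0) 1) 0

theorem midOp_commute_elemMat (hq : q ≠ 0) {b : ℕ} (hb : b ≠ 2) (l m i j : ℕ) :
    Commute (midOp q l) (elemMat q b m i j) := by
  unfold elemMat
  split_ifs
  · apply mono_commute hq
    · simp
    · simp [vchar_apply, hb.symm]
  · exact Commute.zero_right _

/-- The lower trapezoidal factor. -/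
noncomputable def lowFactor (q : k) {n r : ℕ} (h : r ≤ n) (i : Fin n) (l : Fin r) :
    Module.End k (Expo →₀ k) :=
  prodMat q n 0 r 0 i (Fin.castLE h l) * midOp q l

/-- The upper trapezoidal factor. -/
noncomputable def upFactor (q : k) {n r : ℕ} (h : r ≤ n) (l : Fin r) (j : Fin n) :
    Module.End k (Expo →₀ k) :=
  prodMat q n 1 r 0 j (Fin.castLE h l)

variable {n r : ℕ} (hrn : r ≤ n)

theorem lowFactor_isQMat (hq : q ≠ 0) : IsQMat q (lowFactor q hrn) := by
  refine ((prodMat_isQMat hq n 0 r 0).submatrix strictMono_id (Fin.strictMono_castLE hrn)).mul_col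
    (t := fun l : Fin r => midOp q l) (fun l m => ?_) (fun l i j => ?_)
  · exact mono_commute hq (by simp) (by simp)
  · exact commute_prodMat (fun l' _ i' j' => midOp_commute_elemMat hq (by norm_num) _ _ _ _) _ _

theorem upFactor_isQMat (hq : q ≠ 0) : IsQMat q (upFactor q hrn) :=
  ((prodMat_isQMat hq n 1 r 0).submatrix strictMono_id (Fin.strictMono_castLE hrn)).transpose

theorem upFactor_commute_lowFactor (hq : q ≠ 0) (i : Fin n) (l m : Fin r) (j : Fin n) :
    Commute (upFactor q hrn m j) (lowFactor q hrn i l) := by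
  refine Commute.mul_right (prodMat_commute hq (by norm_num) _ _ _ _ _ _ _ _ _) ?_
  exact (commute_prodMat
    (fun l' _ i' j' => midOp_commute_elemMat hq (by norm_num) _ _ _ _) _ _).symm

theorem lowFactor_eq_zero {i : Fin n} {l : Fin r} (h : i.val < l.val) :
    lowFactor q hrn i l = 0 := by
  unfold lowFactor
  rw [prodMat_eq_zero_of_lt (by rw [Fin.lt_def]; exact h), zero_mul]

theorem upFactor_eq_zero {l : Fin r} {j : Fin n} (h : j.val < l.val) :
    upFactor q hrn l j = 0 :=
  prodMat_eq_zero_of_lt (by rw [Fin.lt_def]; exact h)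

theorem isUnit_lowFactor (hq : q ≠ 0) (l : Fin r) :
    IsUnit (lowFactor q hrn (Fin.castLE hrn l) l) := by
  obtain ⟨χ, hχ⟩ := prodMat_diag hq n 0 r 0 (Fin.castLE hrn l)
  unfold lowFactor
  rw [hχ]
  exact (isUnit_mono hq _ _).mul (isUnit_mono hq _ _)

theorem isUnit_upFactor (hq : q ≠ 0) (l : Fin r) :
    IsUnit (upFactor q hrn l (Fin.castLE hrn l)) := by
  obtain ⟨χ, hχ⟩ := prodMat_diag hq n 1 r 0 (Fin.castLE hrn l)
  unfold upFactor
  rw [hχ]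
  exact isUnit_mono hq _ _

/-- The product of the two factors, a quantum matrix of rank `r`. -/
noncomputable def repMat (q : k) {n r : ℕ} (hrn : r ≤ n) (i j : Fin n) :
    Module.End k (Expo →₀ k) :=
  ∑ l : Fin r, lowFactor q hrn i l * upFactor q hrn l j

theorem repMat_isQMat (hq : q ≠ 0) : IsQMat q (repMat q hrn) :=
  (lowFactor_isQMat hrn hq).mul hq (upFactor_isQMat hrn hq) (upFactor_commute_lowFactor hrn hq)

theorem rowMinor_repMat_eq_zero (hq : q ≠ 0) (ro : Fin (r + 1) → Fin n)
    {co : Fin (r + 1) → Fin n} (hco : StrictMono co) : rowMinor q (repMat q hrn) ro co = 0 :=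
  rowMinor_mul_eq_zero hq (Nat.lt_succ_self r) (upFactor_isQMat hrn hq)
    (upFactor_commute_lowFactor hrn hq) ro hco

theorem rowMinor_repMat_leading (hq : q ≠ 0) :
    rowMinor q (repMat q hrn) (Fin.castLE hrn) (Fin.castLE hrn) =
      (List.ofFn fun a : Fin r => lowFactor q hrn (Fin.castLE hrn a) a).prod *
        (List.ofFn fun a : Fin r => upFactor q hrn a (Fin.castLE hrn a)).prod :=
  rowMinor_mul_triangular hq hrn (upFactor_isQMat hrn hq) (upFactor_commute_lowFactor hrn hq)
    (fun _ _ => lowFactor_eq_zero hrn) (fun _ _ => upFactor_eq_zero hrn)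

theorem isUnit_rowMinor_repMat_leading (hq : q ≠ 0) :
    IsUnit (rowMinor q (repMat q hrn) (Fin.castLE hrn) (Fin.castLE hrn)) := by
  rw [rowMinor_repMat_leading hrn hq]
  apply IsUnit.mul
  · apply List.prod_isUnit
    simpa [List.mem_ofFn] using isUnit_lowFactor hrn hq
  · apply List.prod_isUnit
    simpa [List.mem_ofFn] using isUnit_upFactor hrn hq

theorem leading_mul_repMat (hq : q ≠ 0) (i j : Fin n) :
    rowMinor q (repMat q hrn) (Fin.castLE hrn) (Fin.castLE hrn) * repMat q hrn i j =
      ((if i.val < r then 1 else q) * (if j.val < r then 1 else q)) •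
        (repMat q hrn i j * rowMinor q (repMat q hrn) (Fin.castLE hrn) (Fin.castLE hrn)) := by
  rw [rowMinor_repMat_leading hrn hq]
  set D := (List.ofFn fun a : Fin r => lowFactor q hrn (Fin.castLE hrn a) a).prod with hD
  set E := (List.ofFn fun a : Fin r => upFactor q hrn a (Fin.castLE hrn a)).prod with hE
  unfold repMat
  rw [Finset.mul_sum, Finset.sum_mul, Finset.smul_sum]
  refine Finset.sum_congr rfl fun l _ => ?_
  have h1 : D * lowFactor q hrn i l = (if i.val < r then 1 else q) • (lowFactor q hrn i l * D) :=
    diagProd_mul hq hrn (lowFactor_isQMat hrn hq) (fun _ _ => lowFactor_eq_zero hrn) i l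
  have h2 : E * upFactor q hrn l j = (if j.val < r then 1 else q) • (upFactor q hrn l j * E) :=
    diagProd_mul hq hrn (upFactor_isQMat hrn hq).transpose (fun _ _ => upFactor_eq_zero hrn) j l
  have h3 : Commute (lowFactor q hrn i l) E :=
    commute_prod_ofFn (x := fun a : Fin r => upFactor q hrn a (Fin.castLE hrn a))
      fun a => (upFactor_commute_lowFactor hrn hq i l a _).symm
  have h4 : Commute (upFactor q hrn l j) D :=
    commute_prod_ofFn (x := fun a : Fin r => lowFactor q hrn (Fin.castLE hrn a) a)
      fun a => upFactor_commute_lowFactor hrn hq _ _ _ _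
  calc D * E * (lowFactor q hrn i l * upFactor q hrn l j)
      = (D * lowFactor q hrn i l) * (E * upFactor q hrn l j) := by
        rw [mul_assoc, ← mul_assoc E, ← h3.eq]; simp only [mul_assoc]
    _ = ((if i.val < r then 1 else q) * (if j.val < r then 1 else q)) •
        ((lowFactor q hrn i l * D) * (upFactor q hrn l j * E)) := by
        rw [h1, h2, smul_mul_assoc, mul_smul_comm, smul_smul]
    _ = _ := by
        congr 1
        rw [mul_assoc, ← mul_assoc D, ← h4.eq]; simp only [mul_assoc]

end Factorization

section LeadingTerms

variable {k : Type} [Field k] {q : k} {Γ : Type} [AddCommGroup Γ]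

/-- The span of the monomial operators of weight at most `w`. -/
noncomputable def filt (q : k) (ω : Γ →+ ℤ) (w : ℤ) : Submodule k (Module.End k (Γ →₀ k)) :=
  Submodule.span k {T | ∃ v χ, T = mono q v χ ∧ ω v ≤ w}

/-- `T` is a nonzero multiple of a monomial of exponent `v` up to terms of lower weight. -/
def IsLead (q : k) (ω : Γ →+ ℤ) (v : Γ) (T : Module.End k (Γ →₀ k)) : Prop :=
  ∃ c : k, c ≠ 0 ∧ ∃ χ, ∃ R ∈ filt q ω (ω v - 1), T = c • mono q v χ + R

variable {ω : Γ →+ ℤ}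

theorem mono_mem_filt {v : Γ} {w : ℤ} (h : ω v ≤ w) (χ : Γ →+ ℤ) : mono q v χ ∈ filt q ω w :=
  Submodule.subset_span ⟨v, χ, rfl, h⟩

theorem filt_mono {w w' : ℤ} (h : w ≤ w') : filt q ω w ≤ filt q ω w' :=
  Submodule.span_mono fun _ ⟨v, χ, e, hv⟩ => ⟨v, χ, e, hv.trans h⟩

theorem mul_mem_filt (hq : q ≠ 0) {w w' : ℤ} {T T' : Module.End k (Γ →₀ k)}
    (hT : T ∈ filt q ω w) (hT' : T' ∈ filt q ω w') : T * T' ∈ filt q ω (w + w') := by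
  refine Submodule.span_induction₂ (p := fun x y _ _ => x * y ∈ filt q ω (w + w'))
    ?_ ?_ ?_ ?_ ?_ ?_ ?_ hT hT'
  · rintro _ _ ⟨v, χ, rfl, hv⟩ ⟨v', χ', rfl, hv'⟩
    rw [mono_mul hq]
    exact Submodule.smul_mem _ _ (mono_mem_filt (by rw [map_add]; omega) _)
  · intro y _; rw [zero_mul]; exact Submodule.zero_mem _
  · intro x _; rw [mul_zero]; exact Submodule.zero_mem _
  · intro x y z _ _ _ h1 h2; rw [add_mul]; exact Submodule.add_mem _ h1 h2
  · intro x y z _ _ _ h1 h2; rw [mul_add]; exact Submodule.add_mem _ h1 h2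
  · intro c x y _ _ h; rw [smul_mul_assoc]; exact Submodule.smul_mem _ _ h
  · intro c x y _ _ h; rw [mul_smul_comm]; exact Submodule.smul_mem _ _ h

theorem isLead_mono (v : Γ) (χ : Γ →+ ℤ) : IsLead q ω v (mono q v χ) :=
  ⟨1, one_ne_zero, χ, 0, Submodule.zero_mem _, by rw [one_smul, add_zero]⟩

theorem IsLead.mem {v : Γ} {T : Module.End k (Γ →₀ k)} (h : IsLead q ω v T) :
    T ∈ filt q ω (ω v) := by
  obtain ⟨c, -, χ, R, hR, rfl⟩ := h
  exact Submodule.add_mem _ (Submodule.smul_mem _ c (mono_mem_filt le_rfl χ))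
    (filt_mono (by omega) hR)

theorem IsLead.add {v : Γ} {T T' : Module.End k (Γ →₀ k)} (h : IsLead q ω v T)
    (h' : T' ∈ filt q ω (ω v - 1)) : IsLead q ω v (T + T') := by
  obtain ⟨c, hc, χ, R, hR, rfl⟩ := h
  exact ⟨c, hc, χ, R + T', Submodule.add_mem _ hR h', add_assoc _ _ _⟩

theorem IsLead.mul (hq : q ≠ 0) {v v' : Γ} {T T' : Module.End k (Γ →₀ k)} (h : IsLead q ω v T)
    (h' : IsLead q ω v' T') : IsLead q ω (v + v') (T * T') := by
  have hT' := h'.mem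
  obtain ⟨c, hc, χ, R, hR, rfl⟩ := h
  obtain ⟨c', hc', χ', R', hR', rfl⟩ := h'
  refine ⟨c * c' * q ^ χ v', mul_ne_zero (mul_ne_zero hc hc') (zpow_ne_zero _ hq), χ + χ',
    (c • mono q v χ) * R' + R * (c' • mono q v' χ' + R'), ?_, ?_⟩
  · refine Submodule.add_mem _ ?_ ?_
    · exact filt_mono (by rw [map_add]; omega) (mul_mem_filt hq
        (Submodule.smul_mem _ c (mono_mem_filt (q := q) (le_refl (ω v)) χ)) hR')
    · exact filt_mono (by rw [map_add]; omega) (mul_mem_filt hq hR hT')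
  · rw [add_mul, mul_add, smul_mul_smul_comm, mono_mul hq, smul_smul, add_assoc]

theorem isLead_one : IsLead q ω 0 (1 : Module.End k (Γ →₀ k)) := by
  rw [← mono_zero (q := q)]; exact isLead_mono _ _

theorem filt_apply_eq_zero {w : ℤ} {T : Module.End k (Γ →₀ k)} (h : T ∈ filt q ω w) {u : Γ}
    (hu : w < ω u) : T (Finsupp.single 0 1) u = 0 := by
  induction h using Submodule.span_induction with
  | mem T hT =>
    obtain ⟨v, χ, rfl, hv⟩ := hT
    rw [mono_single, Finsupp.single_eq_of_ne']
    rintro rfl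
    rw [zero_add] at hu
    omega
  | zero => simp
  | add x y _ _ h1 h2 => simp [h1, h2]
  | smul c x _ h => simp [h]

theorem IsLead.apply_ne_zero {v : Γ} {T : Module.End k (Γ →₀ k)} (h : IsLead q ω v T) :
    T (Finsupp.single 0 1) v ≠ 0 := by
  obtain ⟨c, hc, χ, R, hR, rfl⟩ := h
  have := filt_apply_eq_zero hR (u := v) (by omega)
  simpa [mono_single, this] using hc

theorem IsLead.apply_eq_zero {v u : Γ} {T : Module.End k (Γ →₀ k)} (h : IsLead q ω v T)
    (hu : ω v = ω u) (hne : v ≠ u) : T (Finsupp.single 0 1) u = 0 := by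
  obtain ⟨c, hc, χ, R, hR, rfl⟩ := h
  have := filt_apply_eq_zero hR (u := u) (by omega)
  simp [mono_single, this, Finsupp.single_eq_of_ne' hne]

end LeadingTerms

section LeadingTermsFactorization

variable {k : Type} [Field k] {q : k} {ω : Expo →+ ℤ}

theorem vint_self (b l i : ℕ) : vint b l i i = 0 := by simp [vint]

theorem vint_add (b l : ℕ) {j s i : ℕ} (h1 : j ≤ s) (h2 : s ≤ i) :
    vint b l j s + vint b l s i = vint b l j i := by
  ext ⟨b', l', s'⟩
  simp only [Finsupp.add_apply, vint_apply]
  split_ifs <;> omega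

theorem map_vint (b l j i : ℕ) :
    ω (vint b l j i) = ∑ s ∈ Finset.Ioc j i, ω (Finsupp.single (b, l, s) 1) := by
  unfold vint; rw [map_sum]

/-- Weights of deeper levels are strictly larger. -/
def LevelStrict (ω : Expo →+ ℤ) (b r : ℕ) : Prop :=
  ∀ l l' s, l < l' → l' < r → l' < s →
    ω (Finsupp.single (b, l, s) 1) < ω (Finsupp.single (b, l', s) 1)

theorem isLead_prodMat (hq : q ≠ 0) {n b r : ℕ} (hω : LevelStrict ω b r) {m l : ℕ}
    (hm : l + m ≤ r) {i j : Fin n} (h1 : l ≤ j.val) (h2 : j.val < l + m) (h3 : j ≤ i) :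
    IsLead q ω (vint b j j i) (prodMat q n b m l i j) := by
  induction m generalizing l i with
  | zero => omega
  | succ m ih =>
    rw [prodMat_succ]
    rw [Fin.le_def] at h3
    rcases h1.eq_or_lt with rfl | h1
    · rw [Finset.sum_eq_single j]
      · obtain ⟨χ, hχ⟩ := prodMat_diag hq n b m (j.val + 1) j
        rw [hχ, elemMat_pos ⟨h3, Or.inr le_rfl⟩, ← add_zero (vint b j j i)]
        simpa using (isLead_mono (vint b j j i) _).mul hq (isLead_mono 0 χ)
      · intro s _ hs
        rw [prodMat_eq_zero_of_col_lt (by omega) hs, mul_zero]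
      · simp
    · rw [← Finset.add_sum_erase _ _ (Finset.mem_univ i)]
      apply IsLead.add
      · rw [elemMat_pos ⟨le_rfl, Or.inl rfl⟩, vint_self, ← zero_add (vint b j j i)]
        exact (isLead_mono _ _).mul hq (ih (by omega) (by omega) (by omega) (by simpa using h3))
      · refine Submodule.sum_mem _ fun s hs => ?_
        have hs := Finset.ne_of_mem_erase hs
        by_cases hsi : s.val ≤ i.val
        swap
        · rw [elemMat_neg (by omega), zero_mul]; exact Submodule.zero_mem _
        by_cases hjs : j ≤ s
        swap
        · rw [prodMat_eq_zero_of_lt (not_le.mp hjs), mul_zero]; exact Submodule.zero_mem _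
        have hlt : s.val < i.val := lt_of_le_of_ne hsi fun h => hs (Fin.ext h)
        rw [elemMat_pos ⟨hsi, Or.inr (h1.le.trans hjs)⟩]
        refine filt_mono ?_ (mul_mem_filt hq (mono_mem_filt le_rfl _)
          (ih (by omega) (by omega) (by omega) hjs).mem)
        rw [← vint_add b j (Fin.le_def.mp hjs) hsi, map_add]
        have : ω (vint b l s i) < ω (vint b j s i) := by
          rw [map_vint, map_vint]
          apply Finset.sum_lt_sum_of_nonempty (Finset.nonempty_Ioc.mpr hlt)
          intro x hx
          rw [Finset.mem_Ioc] at hx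
          have := Fin.le_def.mp hjs
          exact hω _ _ _ h1 (by omega) (by omega)
        omega

/-- Exponent of the level-`l` leading monomial in the `(i, j)` entry. -/
noncomputable def entryExp (l i j : ℕ) : Expo :=
  vint 0 l l i + Finsupp.single (2, l, 0) 1 + vint 1 l l j

variable {n r : ℕ} (hrn : r ≤ n)

theorem isLead_repMat_summand (hq : q ≠ 0) (h0 : LevelStrict ω 0 r) (h1 : LevelStrict ω 1 r)
    {i j : Fin n} {l : Fin r} (hi : l.val ≤ i.val) (hj : l.val ≤ j.val) :
    IsLead q ω (entryExp l i j) (lowFactor q hrn i l * upFactor q hrn l j) := by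
  refine IsLead.mul hq (IsLead.mul hq ?_ (isLead_mono _ _)) ?_
  · exact isLead_prodMat hq h0 (j := Fin.castLE hrn l) (by omega) (by simp) (by simp) hi
  · exact isLead_prodMat hq h1 (j := Fin.castLE hrn l) (by omega) (by simp) (by simp) hj

theorem repMat_summand_eq_zero {i j : Fin n} {l : Fin r} (h : ¬ (l.val ≤ i.val ∧ l.val ≤ j.val)) :
    lowFactor q hrn i l * upFactor q hrn l j = 0 := by
  rcases lt_or_ge i.val l.val with hi | hi
  · rw [lowFactor_eq_zero hrn hi, zero_mul]
  · rw [upFactor_eq_zero hrn (by omega), mul_zero]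

theorem repMat_mem_filt (hq : q ≠ 0) (h0 : LevelStrict ω 0 r) (h1 : LevelStrict ω 1 r)
    {i j : Fin n} {w : ℤ}
    (h : ∀ l : ℕ, l < r → l ≤ i.val → l ≤ j.val → ω (entryExp l i j) ≤ w) :
    repMat q hrn i j ∈ filt q ω w := by
  refine Submodule.sum_mem _ fun l _ => ?_
  by_cases hl : l.val ≤ i.val ∧ l.val ≤ j.val
  · exact filt_mono (h l l.isLt hl.1 hl.2) (isLead_repMat_summand hrn hq h0 h1 hl.1 hl.2).mem
  · rw [repMat_summand_eq_zero hrn hl]; exact Submodule.zero_mem _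

theorem isLead_repMat (hq : q ≠ 0) (h0 : LevelStrict ω 0 r) (h1 : LevelStrict ω 1 r)
    {i j : Fin n} {l₀ : ℕ} (hl : l₀ < r) (hi : l₀ ≤ i.val) (hj : l₀ ≤ j.val)
    (h : ∀ l : ℕ, l < r → l ≤ i.val → l ≤ j.val → l ≠ l₀ →
      ω (entryExp l i j) < ω (entryExp l₀ i j)) :
    IsLead q ω (entryExp l₀ i j) (repMat q hrn i j) := by
  unfold repMat
  rw [← Finset.add_sum_erase _ _ (Finset.mem_univ (⟨l₀, hl⟩ : Fin r))]
  refine (isLead_repMat_summand hrn hq h0 h1 (l := ⟨l₀, hl⟩) hi hj).add ?_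
  refine Submodule.sum_mem _ fun l hl => ?_
  have hne : l.val ≠ l₀ := fun h' => Finset.ne_of_mem_erase hl (Fin.ext h')
  by_cases hl' : l.val ≤ i.val ∧ l.val ≤ j.val
  · exact filt_mono (Int.le_sub_one_of_lt (h l l.isLt hl'.1 hl'.2 hne))
      (isLead_repMat_summand hrn hq h0 h1 hl'.1 hl'.2).mem
  · rw [repMat_summand_eq_zero hrn hl']; exact Submodule.zero_mem _

end LeadingTermsFactorization

section LevelSets

/-- The cells of `F` together with two diagonals outside the `n × n` square. -/
def extCells (n : ℕ) (F : ℕ → ℕ → Prop) (i j : ℕ) : Prop := F i j ∨ j = n + i ∨ i = n + j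

/-- `levelSet n F l` is the set of cells weakly south-east of the end of a strictly increasing
chain of `l + 1` extended cells. -/
def levelSet (n : ℕ) (F : ℕ → ℕ → Prop) : ℕ → ℕ → ℕ → Prop
  | 0 => fun i j => ∃ a ≤ i, ∃ b ≤ j, extCells n F a b
  | l + 1 => fun i j => ∃ a ≤ i, ∃ b ≤ j, extCells n F a b ∧ ∃ a' < a, ∃ b' < b,
      levelSet n F l a' b'

variable {n : ℕ} {F : ℕ → ℕ → Prop}

theorem levelSet_mono {l i j i' j' : ℕ} (hi : i ≤ i') (hj : j ≤ j') (h : levelSet n F l i j) :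
    levelSet n F l i' j' := by
  cases l with
  | zero => obtain ⟨a, ha, b, hb, h⟩ := h; exact ⟨a, ha.trans hi, b, hb.trans hj, h⟩
  | succ l => obtain ⟨a, ha, b, hb, h⟩ := h; exact ⟨a, ha.trans hi, b, hb.trans hj, h⟩

theorem levelSet_succ_pred {l i j : ℕ} (h : levelSet n F (l + 1) i j) :
    ∃ a < i, ∃ b < j, levelSet n F l a b := by
  obtain ⟨a, ha, b, hb, -, a', ha', b', hb', h⟩ := h
  exact ⟨a', ha'.trans_le ha, b', hb'.trans_le hb, h⟩

theorem levelSet_of_succ {l i j : ℕ} (h : levelSet n F (l + 1) i j) : levelSet n F l i j := by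
  obtain ⟨a, ha, b, hb, h⟩ := levelSet_succ_pred h
  exact levelSet_mono ha.le hb.le h

theorem levelSet_of_le {l l' i j : ℕ} (hl : l ≤ l') (h : levelSet n F l' i j) :
    levelSet n F l i j := by
  induction hl with
  | refl => exact h
  | step _ ih => exact ih (levelSet_of_succ h)

theorem le_of_levelSet {l i j : ℕ} (h : levelSet n F l i j) : l ≤ i ∧ l ≤ j := by
  induction l generalizing i j with
  | zero => omega
  | succ l ih =>
    obtain ⟨a, ha, b, hb, h⟩ := levelSet_succ_pred h
    have := ih h
    omega

theorem levelSet_diag (l : ℕ) : levelSet n F l l (n + l) := by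
  induction l with
  | zero => exact ⟨0, le_rfl, n, le_rfl, Or.inr (Or.inl rfl)⟩
  | succ l ih =>
    exact ⟨l + 1, le_rfl, n + (l + 1), le_rfl, Or.inr (Or.inl rfl), l, by omega, n + l, by omega,
      ih⟩

theorem extCells_flip {i j : ℕ} : extCells n (flip F) j i ↔ extCells n F i j := by
  unfold extCells flip
  tauto

theorem levelSet_flip {l i j : ℕ} : levelSet n (flip F) l j i ↔ levelSet n F l i j := by
  induction l generalizing i j with
  | zero =>
    simp only [levelSet, extCells_flip]
    constructor <;> rintro ⟨a, ha, b, hb, h⟩ <;> exact ⟨b, hb, a, ha, h⟩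
  | succ l ih =>
    simp only [levelSet, extCells_flip, ih]
    constructor <;> rintro ⟨a, ha, b, hb, h, c, hc, d, hd, h'⟩ <;>
      exact ⟨b, hb, a, ha, h, d, hd, c, hc, h'⟩

theorem exists_chain_of_levelSet {l i j : ℕ} (hi : i < n) (hj : j < n)
    (h : levelSet n F l i j) :
    ∃ ro co : ℕ → ℕ, (∀ a b, a < b → b ≤ l → ro a < ro b ∧ co a < co b) ∧
      (∀ a ≤ l, F (ro a) (co a)) ∧ ro l ≤ i ∧ co l ≤ j := by
  have key : ∀ a b, a ≤ i → b ≤ j → extCells n F a b → F a b := by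
    rintro a b ha hb (h | h | h)
    · exact h
    · omega
    · omega
  induction l generalizing i j with
  | zero =>
    obtain ⟨a, ha, b, hb, h⟩ := h
    refine ⟨fun _ => a, fun _ => b, fun _ _ _ _ => by omega, fun _ _ => key a b ha hb h, ha, hb⟩
  | succ l ih =>
    obtain ⟨a, ha, b, hb, h, a', ha', b', hb', h'⟩ := h
    obtain ⟨ro, co, h1, h2, h3, h4⟩ := ih (by omega) (by omega) h'
      fun c d hc hd => key c d (by omega) (by omega)
    have hle : ∀ c ≤ l, ro c ≤ ro l ∧ co c ≤ co l := by
      intro c hc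
      rcases hc.eq_or_lt with rfl | hc
      · exact ⟨le_rfl, le_rfl⟩
      · exact ⟨(h1 c l hc le_rfl).1.le, (h1 c l hc le_rfl).2.le⟩
    refine ⟨fun c => if c ≤ l then ro c else a, fun c => if c ≤ l then co c else b, ?_, ?_, ?_, ?_⟩
    · intro c d hcd hd
      dsimp only
      have hc : c ≤ l := by omega
      rw [if_pos hc, if_pos hc]
      split_ifs with hdl
      · exact h1 c d hcd hdl
      · have := hle c (by omega)
        omega
    · intro c hc
      dsimp only
      split_ifs with hcl
      · exact h2 c hcl
      · exact key a b ha hb h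
    · simpa using ha
    · simpa using hb

end LevelSets

section Weights

open Classical in
/-- Number of cells violating the corner condition at `(i, j)` inside the `K × K` square. -/
noncomputable def cellDefect (K : ℕ) (R : ℕ → ℕ → Prop) (i j : ℕ) : ℤ :=
  ∑ a ∈ Finset.range K, ∑ b ∈ Finset.range K,
    ((if a < i ∧ b < j ∧ R a b then 1 else 0) + (if i ≤ a ∧ j ≤ b ∧ ¬ R a b then 1 else 0))

open Classical in
/-- Number of cells of row `i` outside `R`. -/
noncomputable def rowCount (K : ℕ) (R : ℕ → ℕ → Prop) (i : ℕ) : ℤ :=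
  ∑ b ∈ Finset.range K, if R i b then 0 else 1

theorem cellDefect_nonneg (K : ℕ) (R : ℕ → ℕ → Prop) (i j : ℕ) : 0 ≤ cellDefect K R i j :=
  Finset.sum_nonneg fun a _ => Finset.sum_nonneg fun b _ => by positivity

theorem cellDefect_eq_zero_iff {K : ℕ} {R : ℕ → ℕ → Prop} {i j : ℕ} :
    cellDefect K R i j = 0 ↔ ∀ a < K, ∀ b < K, (a < i → b < j → ¬ R a b) ∧
      (i ≤ a → j ≤ b → R a b) := by
  classical
  unfold cellDefect
  rw [Finset.sum_eq_zero_iff_of_nonneg fun a _ => Finset.sum_nonneg fun b _ => by positivity]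
  simp only [Finset.mem_range]
  refine forall₂_congr fun a ha => ?_
  rw [Finset.sum_eq_zero_iff_of_nonneg fun b _ => by positivity]
  simp only [Finset.mem_range]
  refine forall₂_congr fun b hb => ?_
  by_cases h : R a b
  · simp only [h, and_true, not_true_eq_false, and_false, if_false, add_zero, imp_false]
    split_ifs <;> simp <;> first | tauto | (intro; omega)
  · simp only [h, and_true, not_false_eq_true, and_false, if_false, zero_add, imp_false]
    split_ifs <;> simp <;> first | tauto | (intro; omega)

theorem sum_range_ite_lt {K j : ℕ} (hj : j ≤ K) :
    (∑ b ∈ Finset.range K, if b < j then (1 : ℤ) else 0) = j := by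
  rw [Finset.sum_ite, Finset.sum_const_zero, add_zero, Finset.sum_const]
  have : (Finset.range K).filter (· < j) = Finset.range j := by
    ext x; simp only [Finset.mem_filter, Finset.mem_range]; omega
  rw [this]; simp

theorem cellDefect_flip (K : ℕ) (R : ℕ → ℕ → Prop) (i j : ℕ) :
    cellDefect K (flip R) j i = cellDefect K R i j := by
  unfold cellDefect flip
  rw [Finset.sum_comm]
  refine Finset.sum_congr rfl fun a _ => Finset.sum_congr rfl fun b _ => ?_
  congr 1 <;> congr 1 <;> simp only [eq_iff_iff] <;> tauto

theorem cellDefect_succ {K : ℕ} (R : ℕ → ℕ → Prop) {i j : ℕ} (hi : i < K) (hj : j ≤ K) :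
    cellDefect K R (i + 1) j = cellDefect K R i j + j - rowCount K R i := by
  classical
  rw [← sum_range_ite_lt hj]
  have h1 : cellDefect K R (i + 1) j - cellDefect K R i j =
      ∑ a ∈ Finset.range K, if a = i then
        ∑ b ∈ Finset.range K, ((if b < j then (1 : ℤ) else 0) - (if R a b then 0 else 1))
      else 0 := by
    unfold cellDefect
    rw [← Finset.sum_sub_distrib]
    refine Finset.sum_congr rfl fun a _ => ?_
    rw [← Finset.sum_sub_distrib]
    split_ifs with h
    · refine Finset.sum_congr rfl fun b _ => ?_
      subst h
      by_cases hR : R a b <;>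
        simp only [hR, and_true, and_false, not_true_eq_false, not_false_eq_true, if_false] <;>
        split_ifs <;> omega
    · refine Finset.sum_eq_zero fun b _ => ?_
      by_cases hR : R a b <;>
        simp only [hR, and_true, and_false, not_true_eq_false, not_false_eq_true, if_false] <;>
        split_ifs <;> omega
  rw [Finset.sum_ite_eq' , if_pos (Finset.mem_range.mpr hi), Finset.sum_sub_distrib] at h1
  unfold rowCount
  omega

theorem mul_sub_cellDefect {K : ℕ} (R : ℕ → ℕ → Prop) {l i j : ℕ} (hli : l ≤ i) (hlj : l ≤ j)
    (hi : i ≤ K) (hj : j ≤ K) :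
    (i * j : ℤ) - cellDefect K R i j = ∑ s ∈ Finset.Ico l i, rowCount K R s +
      (l * l - cellDefect K R l l) + ∑ s ∈ Finset.Ico l j, rowCount K (flip R) s := by
  induction i, hli using Nat.le_induction with
  | base =>
    rw [Finset.Ico_self, Finset.sum_empty, zero_add]
    induction j, hlj using Nat.le_induction with
    | base => simp
    | succ j hlj ih =>
      have h1 := cellDefect_succ (flip R) (i := j) (j := l) (K := K) (by omega) hi
      rw [cellDefect_flip, cellDefect_flip] at h1
      rw [Finset.sum_Ico_succ_top hlj, h1]
      have := ih (by omega)
      push_cast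
      linarith
  | succ i hli ih =>
    have h1 := cellDefect_succ R (i := i) (j := j) (K := K) (by omega) hj
    rw [Finset.sum_Ico_succ_top hli, h1]
    have := ih (by omega)
    push_cast
    linarith

theorem rowCount_lt {n r : ℕ} (F : ℕ → ℕ → Prop) {l l' i : ℕ} (hl : l < l') (hl' : l' < r)
    (hi : l' ≤ i) :
    rowCount (n + r) (levelSet n F l) i < rowCount (n + r) (levelSet n F l') i := by
  classical
  have hex : ∃ b, levelSet n F l i b := ⟨n + l, levelSet_mono (by omega) le_rfl (levelSet_diag l)⟩
  have h0 := Nat.find_spec hex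
  have hmin : ∀ b < Nat.find hex, ¬ levelSet n F l i b := fun b hb => Nat.find_min hex hb
  have hle : Nat.find hex ≤ n + l :=
    Nat.find_min' hex (levelSet_mono (by omega) le_rfl (levelSet_diag l))
  unfold rowCount
  apply Finset.sum_lt_sum
  · intro b _
    by_cases h : levelSet n F l' i b
    · rw [if_pos h, if_pos (levelSet_of_le hl.le h)]
    · rw [if_neg h]; split_ifs <;> norm_num
  · refine ⟨Nat.find hex, Finset.mem_range.mpr (by omega), ?_⟩
    rw [if_pos h0, if_neg]
    · norm_num
    · intro h
      obtain ⟨a, ha, b, hb, h⟩ := levelSet_succ_pred (levelSet_of_le hl h)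
      exact hmin b hb (levelSet_mono ha.le le_rfl h)

/-- The weights of the coordinates. -/
noncomputable def coordWeight (n r : ℕ) (F : ℕ → ℕ → Prop) : ℕ × ℕ × ℕ → ℤ
  | (0, l, s) => rowCount (n + r) (levelSet n F l) (s - 1)
  | (1, l, s) => rowCount (n + r) (levelSet n (flip F) l) (s - 1)
  | (_, l, _) => l * l - cellDefect (n + r) (levelSet n F l) l l

/-- The weight functional attached to a set of cells. -/
noncomputable def cellWeight (n r : ℕ) (F : ℕ → ℕ → Prop) : Expo →+ ℤ :=
  (Finsupp.linearCombination ℤ (coordWeight n r F)).toAddMonoidHom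

variable {n r : ℕ} {F : ℕ → ℕ → Prop}

theorem cellWeight_single (x : ℕ × ℕ × ℕ) :
    cellWeight n r F (Finsupp.single x 1) = coordWeight n r F x := by
  simp [cellWeight]

theorem levelStrict_cellWeight_zero : LevelStrict (cellWeight n r F) 0 r := by
  intro l l' s h1 h2 h3
  rw [cellWeight_single, cellWeight_single]
  exact rowCount_lt F h1 h2 (by omega)

theorem levelStrict_cellWeight_one : LevelStrict (cellWeight n r F) 1 r := by
  intro l l' s h1 h2 h3
  rw [cellWeight_single, cellWeight_single]
  exact rowCount_lt (flip F) h1 h2 (by omega)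

theorem cellWeight_entryExp {l i j : ℕ} (hli : l ≤ i) (hlj : l ≤ j) (hi : i < n) (hj : j < n) :
    cellWeight n r F (entryExp l i j) =
      i * j - cellDefect (n + r) (levelSet n F l) i j := by
  have hflip : flip (levelSet n F l) = levelSet n (flip F) l := by
    funext a b; exact propext levelSet_flip.symm
  have key : ∀ (g : ℕ → ℤ) (i : ℕ), ∑ s ∈ Finset.Ioc l i, g (s - 1) =
      ∑ s ∈ Finset.Ico l i, g s := by
    intro g i
    refine Finset.sum_nbij' (· - 1) (· + 1) ?_ ?_ ?_ ?_ ?_ <;>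
      simp only [Finset.mem_Ioc, Finset.mem_Ico] <;> intro x hx
    all_goals first | omega | trivial
  rw [mul_sub_cellDefect _ hli hlj (by omega) (by omega), hflip]
  unfold entryExp
  rw [map_add, map_add, map_vint, map_vint]
  simp only [cellWeight_single, coordWeight]
  rw [key (rowCount (n + r) (levelSet n F l)), key (rowCount (n + r) (levelSet n (flip F) l))]

/-- The level-`l` leading exponent of the cell `(i, j)` attains the maximal weight `i * j`. -/
def Tight (ω : Expo →+ ℤ) (r l i j : ℕ) : Prop :=
  l < r ∧ l ≤ i ∧ l ≤ j ∧ ω (entryExp l i j) = i * j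

theorem Tight.levelSet {l i j : ℕ} (hi : i < n) (hj : j < n) (h : Tight (cellWeight n r F) r l i j) :
    levelSet n F l i j ∧ ∀ a < i, ∀ b < j, ¬ levelSet n F l a b := by
  obtain ⟨-, hli, hlj, h⟩ := h
  rw [cellWeight_entryExp hli hlj hi hj] at h
  have h0 : cellDefect (n + r) (_root_.levelSet n F l) i j = 0 := by linarith
  rw [cellDefect_eq_zero_iff] at h0
  exact ⟨(h0 i (by omega) j (by omega)).2 le_rfl le_rfl,
    fun a ha b hb => (h0 a (by omega) b (by omega)).1 ha hb⟩

theorem Tight.level_unique {l l' i j : ℕ} (hi : i < n) (hj : j < n)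
    (h : Tight (cellWeight n r F) r l i j) (h' : Tight (cellWeight n r F) r l' i j) : l = l' := by
  have key : ∀ l l', Tight (cellWeight n r F) r l i j → Tight (cellWeight n r F) r l' i j →
      ¬ l < l' := by
    intro l l' h h' hlt
    obtain ⟨a, ha, b, hb, hab⟩ := levelSet_succ_pred (levelSet_of_le hlt (h'.levelSet hi hj).1)
    exact (h.levelSet hi hj).2 a ha b hb hab
  have h1 := key l l' h h'
  have h2 := key l' l h' h
  omega

theorem Tight.not_lt {l i j i' j' : ℕ} (hi : i < n) (hj : j < n) (hi' : i' < n) (hj' : j' < n)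
    (h : Tight (cellWeight n r F) r l i j) (h' : Tight (cellWeight n r F) r l i' j')
    (h1 : i < i') : ¬ j < j' :=
  fun h2 => (h'.levelSet hi' hj').2 i h1 j h2 (h.levelSet hi hj).1

theorem cellWeight_entryExp_le {l i j : ℕ} (hli : l ≤ i) (hlj : l ≤ j) (hi : i < n) (hj : j < n) :
    cellWeight n r F (entryExp l i j) ≤ i * j := by
  rw [cellWeight_entryExp hli hlj hi hj]
  have := cellDefect_nonneg (n + r) (levelSet n F l) i j
  omega

theorem exists_tight {i j : ℕ} (hi : i < n) (hj : j < n) (hF : F i j)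
    (hchain : ¬ ∃ ro co : ℕ → ℕ, (∀ a b, a < b → b ≤ r → ro a < ro b ∧ co a < co b) ∧
      (∀ a ≤ r, F (ro a) (co a)) ∧ ro r ≤ i ∧ co r ≤ j) :
    ∃ l, Tight (cellWeight n r F) r l i j := by
  classical
  have hex : ∃ l, ∀ a < i, ∀ b < j, ¬ levelSet n F l a b := by
    refine ⟨i, fun a ha b _ h => ?_⟩
    have := (le_of_levelSet h).1
    omega
  obtain ⟨l, h0, hmin⟩ : ∃ l, (∀ a < i, ∀ b < j, ¬ levelSet n F l a b) ∧
      ∀ m < l, ¬ ∀ a < i, ∀ b < j, ¬ levelSet n F m a b :=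
    ⟨Nat.find hex, Nat.find_spec hex, fun m hm => Nat.find_min hex hm⟩
  have hl : levelSet n F l i j := by
    cases l with
    | zero => exact ⟨i, le_rfl, j, le_rfl, Or.inl hF⟩
    | succ l =>
      have := hmin l (Nat.lt_succ_self l)
      push Not at this
      obtain ⟨a, ha, b, hb, h⟩ := this
      exact ⟨i, le_rfl, j, le_rfl, Or.inl hF, a, ha, b, hb, h⟩
  have hle := le_of_levelSet hl
  refine ⟨l, ?_, hle.1, hle.2, ?_⟩
  · by_contra hlr
    exact hchain (exists_chain_of_levelSet hi hj (levelSet_of_le (not_lt.mp hlr) hl))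
  · rw [cellWeight_entryExp hle.1 hle.2 hi hj, cellDefect_eq_zero_iff.mpr, sub_zero]
    exact fun a _ b _ => ⟨fun ha hb => h0 a ha b hb, fun ha hb => levelSet_mono ha hb hl⟩

end Weights

section ExponentIndependence

theorem exists_ne_of_sum_ite_eq_zero {α : Type} [Fintype α] {P : α → Prop} [DecidablePred P]
    {δ : α → ℤ} (h : ∑ p, (if P p then δ p else 0) = 0) {p : α} (hp : P p) (hδ : δ p ≠ 0) :
    ∃ p', p' ≠ p ∧ P p' ∧ δ p' ≠ 0 := by
  by_contra! hcon
  rw [Finset.sum_eq_single p, if_pos hp] at h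
  · exact hδ h
  · intro p' _ hp'
    split_ifs with hP
    · exact hcon p' hp' hP
    · rfl
  · simp

/-- An integer function on cells whose row and column sums on every level vanish is zero, if no
two cells of the same level are in strictly south-east position. -/
theorem eq_zero_of_row_col_sums {n : ℕ} {δ : Fin n × Fin n → ℤ} {lev : Fin n × Fin n → ℕ}
    (hrow : ∀ (l : ℕ) (i : Fin n), ∑ p, (if lev p = l ∧ p.1 = i then δ p else 0) = 0)
    (hcol : ∀ (l : ℕ) (j : Fin n), ∑ p, (if lev p = l ∧ p.2 = j then δ p else 0) = 0)
    (hcross : ∀ p p', δ p ≠ 0 → δ p' ≠ 0 → lev p = lev p' → p.1 < p'.1 → ¬ p.2 < p'.2)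
    (p : Fin n × Fin n) : δ p = 0 := by
  by_contra hp
  have hne : (Finset.univ.filter fun p => δ p ≠ 0).Nonempty := ⟨p, by simpa using hp⟩
  obtain ⟨a, ha, hmax⟩ := Finset.exists_max_image _ (fun p : Fin n × Fin n => p.1) hne
  have hne' : (Finset.univ.filter fun p => δ p ≠ 0 ∧ p.1 = a.1).Nonempty :=
    ⟨a, by simpa using ha⟩
  obtain ⟨b, hb, hmin⟩ := Finset.exists_min_image _ (fun p : Fin n × Fin n => p.2) hne'
  simp only [Finset.mem_filter, Finset.mem_univ, true_and, and_imp] at ha hmax hb hmin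
  obtain ⟨c, hcb, ⟨hcl, hcr⟩, hc⟩ := exists_ne_of_sum_ite_eq_zero (hrow (lev b) b.1) ⟨rfl, rfl⟩ hb.1
  obtain ⟨d, hdb, ⟨hdl, hdc⟩, hd⟩ := exists_ne_of_sum_ite_eq_zero (hcol (lev b) b.2) ⟨rfl, rfl⟩ hb.1
  have h1 : b.2 < c.2 := lt_of_le_of_ne (hmin c hc (hcr.trans hb.2))
    fun h => hcb (Prod.ext hcr h.symm)
  have h2 : d.1 < b.1 := lt_of_le_of_ne (hb.2 ▸ hmax d hd) fun h => hdb (Prod.ext h hdc)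
  exact hcross d c hd hc (hdl.trans hcl.symm) (hcr ▸ h2) (hdc ▸ h1)

theorem entryExp_apply_zero (l i j l' s : ℕ) :
    entryExp l i j (0, l', s) = if l = l' ∧ l' < s ∧ s ≤ i then 1 else 0 := by
  by_cases h : l = l'
  · subst h
    simp [entryExp, vint_apply]
  · simp [entryExp, vint_apply, h, Ne.symm h]

theorem entryExp_apply_one (l i j l' s : ℕ) :
    entryExp l i j (1, l', s) = if l = l' ∧ l' < s ∧ s ≤ j then 1 else 0 := by
  by_cases h : l = l'
  · subst h
    simp [entryExp, vint_apply]
  · simp [entryExp, vint_apply, h, Ne.symm h]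

theorem entryExp_apply_two (l i j l' : ℕ) :
    entryExp l i j (2, l', 0) = if l = l' then 1 else 0 := by
  simp [entryExp, vint_apply, Finsupp.single_apply]

theorem sum_ite_eq_zero_of_tails {α : Type} [Fintype α] {δ : α → ℤ} {lev f : α → ℕ}
    (hle : ∀ p, δ p ≠ 0 → lev p ≤ f p)
    (h0 : ∀ l, ∑ p, (if lev p = l then δ p else 0) = 0)
    (h1 : ∀ l s, ∑ p, (if lev p = l ∧ l < s ∧ s ≤ f p then δ p else 0) = 0) (l i : ℕ) :
    ∑ p, (if lev p = l ∧ f p = i then δ p else 0) = 0 := by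
  have key : ∀ s, ∑ p, (if lev p = l ∧ s ≤ f p then δ p else 0) = 0 := by
    intro s
    rcases lt_or_ge l s with hs | hs
    · simpa [hs] using h1 l s
    · refine Eq.trans (Finset.sum_congr rfl fun p _ => ?_) (h0 l)
      by_cases hp : δ p = 0
      · simp [hp]
      · have := hle p hp
        congr 1
        simp only [eq_iff_iff, and_iff_left_iff_imp]
        omega
  have e : ∑ p, (if lev p = l ∧ f p = i then δ p else 0) =
      ∑ p, (if lev p = l ∧ i ≤ f p then δ p else 0) -
        ∑ p, (if lev p = l ∧ i + 1 ≤ f p then δ p else 0) := by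
    rw [← Finset.sum_sub_distrib]
    refine Finset.sum_congr rfl fun p _ => ?_
    split_ifs <;> omega
  rw [e, key, key, sub_zero]

variable {n r : ℕ} {F : ℕ → ℕ → Prop}

open Classical in
/-- The level of a tight cell. -/
noncomputable def cellLevel (ω : Expo →+ ℤ) (r : ℕ) (p : Fin n × Fin n) : ℕ :=
  if h : ∃ l, Tight ω r l p.1 p.2 then h.choose else 0

theorem tight_cellLevel {ω : Expo →+ ℤ} {p : Fin n × Fin n} (h : ∃ l, Tight ω r l p.1 p.2) :
    Tight ω r (cellLevel ω r p) p.1 p.2 := by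
  unfold cellLevel
  rw [dif_pos h]
  exact h.choose_spec

/-- The exponent of the leading term of a cell. -/
noncomputable def cellExp (ω : Expo →+ ℤ) (r : ℕ) (p : Fin n × Fin n) : Expo :=
  entryExp (cellLevel ω r p) p.1 p.2

/-- Multisets of tight cells are determined by their total exponent. -/
theorem multiset_eq_of_sum_cellExp_eq {μ ν : Multiset (Fin n × Fin n)}
    (hμ : ∀ p ∈ μ, ∃ l, Tight (cellWeight n r F) r l p.1 p.2)
    (hν : ∀ p ∈ ν, ∃ l, Tight (cellWeight n r F) r l p.1 p.2)
    (h : (μ.map (cellExp (cellWeight n r F) r)).sum = (ν.map (cellExp (cellWeight n r F) r)).sum) :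
    μ = ν := by
  classical
  set ω := cellWeight n r F with hω
  let δ : Fin n × Fin n → ℤ := fun p => (μ.count p : ℤ) - ν.count p
  have hδ : ∀ p, δ p ≠ 0 → ∃ l, Tight ω r l p.1 p.2 := by
    intro p hp
    by_cases h1 : p ∈ μ
    · exact hμ p h1
    by_cases h2 : p ∈ ν
    · exact hν p h2
    exact absurd (by simp [δ, h1, h2]) hp
  have hsum : ∑ p, δ p • cellExp ω r p = 0 := by
    have e : ∀ μ : Multiset (Fin n × Fin n), (μ.map (cellExp ω r)).sum =
        ∑ p, (μ.count p : ℤ) • cellExp ω r p := by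
      intro μ
      rw [Finset.sum_multiset_map_count]
      simp only [natCast_zsmul]
      refine Finset.sum_subset (Finset.subset_univ _) fun p _ hp => ?_
      rw [Multiset.count_eq_zero_of_notMem (by simpa using hp), zero_smul]
    simp only [δ, sub_smul, Finset.sum_sub_distrib]
    rw [← e, ← e, h, sub_self]
  have heval : ∀ x, ∑ p, δ p * cellExp ω r p x = 0 := by
    intro x
    have := congrArg (fun v : Expo => v x) hsum
    simpa [Finsupp.finsetSum_apply] using this
  have h0 : ∀ l, ∑ p, (if cellLevel ω r p = l then δ p else 0) = 0 := by
    intro l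
    simpa [cellExp, entryExp_apply_two] using heval (2, l, 0)
  have hzero := eq_zero_of_row_col_sums (δ := δ) (lev := cellLevel ω r) ?_ ?_ ?_
  · ext p
    have := hzero p
    simp only [δ] at this
    omega
  · intro l i
    have := sum_ite_eq_zero_of_tails (δ := δ) (lev := cellLevel ω r) (f := fun p => p.1.val)
      (fun p hp => (tight_cellLevel (hδ p hp)).2.1) h0
      (fun l s => by simpa [cellExp, entryExp_apply_zero] using heval (0, l, s)) l i
    simpa [Fin.ext_iff] using this
  · intro l j
    have := sum_ite_eq_zero_of_tails (δ := δ) (lev := cellLevel ω r) (f := fun p => p.2.val)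
      (fun p hp => (tight_cellLevel (hδ p hp)).2.2.1) h0
      (fun l s => by simpa [cellExp, entryExp_apply_one] using heval (1, l, s)) l j
    simpa [Fin.ext_iff] using this
  · intro p p' hp hp' hl h1 h2
    have t1 := tight_cellLevel (hδ p hp)
    have t2 := tight_cellLevel (hδ p' hp')
    rw [← hl] at t2
    exact Tight.not_lt p.1.isLt p.2.isLt p'.1.isLt p'.2.isLt t1 t2 h1 h2

end ExponentIndependence

section Spanning

variable {k : Type} [Field k] {q : k} {B : Type} [Ring B] [Algebra k B] {n : ℕ}

/-- The product of the entries of a matrix along a word of cells. -/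
def wordProd (X : Fin n → Fin n → B) (w : List (Fin n × Fin n)) : B :=
  (w.map fun p => X p.1 p.2).prod

/-- The weight of a word of cells. -/
def wordWeight (w : List (Fin n × Fin n)) : ℕ := (w.map fun p => p.1.val * p.2.val).sum

/-- The span of the words of weight less than `N`. -/
def lowSpan (k : Type) [Field k] [Algebra k B] (X : Fin n → Fin n → B) (N : ℕ) : Submodule k B :=
  Submodule.span k {x | ∃ w, wordWeight w < N ∧ x = wordProd X w}

theorem wordProd_append {B : Type} [Ring B] (X : Fin n → Fin n → B) (w w' : List (Fin n × Fin n)) :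
    wordProd X (w ++ w') = wordProd X w * wordProd X w' := by
  simp [wordProd]

theorem wordWeight_append (w w' : List (Fin n × Fin n)) :
    wordWeight (w ++ w') = wordWeight w + wordWeight w' := by
  simp [wordWeight]

theorem wordWeight_perm {w w' : List (Fin n × Fin n)} (h : w.Perm w') :
    wordWeight w = wordWeight w' := (h.map _).sum_eq

variable {X : Fin n → Fin n → B}

theorem wordProd_mem_lowSpan {w : List (Fin n × Fin n)} {N : ℕ} (h : wordWeight w < N) :
    wordProd X w ∈ lowSpan k X N := Submodule.subset_span ⟨w, h, rfl⟩

theorem wordProd_mul_mem_lowSpan {N : ℕ} {x : B} (hx : x ∈ lowSpan k X N)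
    (u : List (Fin n × Fin n)) : wordProd X u * x ∈ lowSpan k X (wordWeight u + N) := by
  induction hx using Submodule.span_induction with
  | mem x hx =>
    obtain ⟨w, hw, rfl⟩ := hx
    rw [← wordProd_append]
    exact wordProd_mem_lowSpan (by rw [wordWeight_append]; omega)
  | zero => rw [mul_zero]; exact Submodule.zero_mem _
  | add x y _ _ hx hy => rw [mul_add]; exact Submodule.add_mem _ hx hy
  | smul c x _ hx => rw [mul_smul_comm]; exact Submodule.smul_mem _ _ hx

theorem mul_wordProd_mem_lowSpan {N : ℕ} {x : B} (hx : x ∈ lowSpan k X N)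
    (u : List (Fin n × Fin n)) : x * wordProd X u ∈ lowSpan k X (N + wordWeight u) := by
  induction hx using Submodule.span_induction with
  | mem x hx =>
    obtain ⟨w, hw, rfl⟩ := hx
    rw [← wordProd_append]
    exact wordProd_mem_lowSpan (by rw [wordWeight_append]; omega)
  | zero => rw [zero_mul]; exact Submodule.zero_mem _
  | add x y _ _ hx hy => rw [add_mul]; exact Submodule.add_mem _ hx hy
  | smul c x _ hx => rw [smul_mul_assoc]; exact Submodule.smul_mem _ _ hx

theorem IsQMat.exists_swap (hq : q ≠ 0) (hX : IsQMat q X) (p p' : Fin n × Fin n) :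
    ∃ c : k, wordProd X [p, p'] - c • wordProd X [p', p] ∈ lowSpan k X (wordWeight [p, p']) := by
  obtain ⟨i, j⟩ := p
  obtain ⟨s, t⟩ := p'
  have hlow : ∀ {i s j t : Fin n}, i < s → j < t →
      X i t * X s j ∈ lowSpan k X (i * j + s * t) := by
    intro i s j t h1 h2
    have := wordProd_mem_lowSpan (k := k) (X := X) (w := [(i, t), (s, j)]) (N := i * j + s * t) (by
      simp only [wordWeight, List.map_cons, List.map_nil, List.sum_cons, List.sum_nil, add_zero]
      rw [Fin.lt_def] at h1 h2
      nlinarith)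
    simpa [wordProd] using this
  simp only [wordProd, wordWeight, List.map_cons, List.map_nil, List.prod_cons, List.prod_nil,
    mul_one, List.sum_cons, List.sum_nil, add_zero]
  rcases lt_trichotomy i s with h1 | rfl | h1 <;> rcases lt_trichotomy j t with h2 | rfl | h2
  · refine ⟨1, ?_⟩
    rw [hX.diag i s j t h1 h2, one_smul, add_sub_cancel_left]
    exact Submodule.smul_mem _ _ (hlow h1 h2)
  · exact ⟨q, by rw [hX.col i s j h1, sub_self]; exact Submodule.zero_mem _⟩
  · exact ⟨1, by rw [hX.cross i s j t h1 h2, one_smul, sub_self]; exact Submodule.zero_mem _⟩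
  · exact ⟨q, by rw [hX.row i j t h2, sub_self]; exact Submodule.zero_mem _⟩
  · exact ⟨1, by rw [one_smul, sub_self]; exact Submodule.zero_mem _⟩
  · refine ⟨q⁻¹, ?_⟩
    rw [hX.row i t j h2, smul_smul, inv_mul_cancel₀ hq, one_smul, sub_self]
    exact Submodule.zero_mem _
  · exact ⟨1, by rw [hX.cross s i t j h1 h2, one_smul, sub_self]; exact Submodule.zero_mem _⟩
  · refine ⟨q⁻¹, ?_⟩
    rw [hX.col s i j h1, smul_smul, inv_mul_cancel₀ hq, one_smul, sub_self]
    exact Submodule.zero_mem _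
  · refine ⟨1, ?_⟩
    rw [hX.diag s i t j h1 h2, one_smul, sub_add_cancel_left]
    refine Submodule.neg_mem _ (Submodule.smul_mem _ _ ?_)
    rw [add_comm]
    exact hlow h1 h2

/-- Permuting a word changes its product by a scalar, up to words of lower weight. -/
theorem IsQMat.exists_perm (hq : q ≠ 0) (hX : IsQMat q X) {w w' : List (Fin n × Fin n)}
    (h : w.Perm w') :
    ∃ c : k, wordProd X w - c • wordProd X w' ∈ lowSpan k X (wordWeight w) := by
  induction h with
  | nil => exact ⟨1, by rw [one_smul, sub_self]; exact Submodule.zero_mem _⟩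
  | @cons p l l' _ ih =>
    obtain ⟨c, hc⟩ := ih
    refine ⟨c, ?_⟩
    have := wordProd_mul_mem_lowSpan hc [p]
    rwa [mul_sub, mul_smul_comm, ← wordProd_append, ← wordProd_append, ← wordWeight_append] at this
  | swap p p' l =>
    obtain ⟨c, hc⟩ := hX.exists_swap hq p' p
    refine ⟨c, ?_⟩
    have := mul_wordProd_mem_lowSpan hc l
    rwa [sub_mul, smul_mul_assoc, ← wordProd_append, ← wordProd_append,
      ← wordWeight_append] at this
  | trans h _ ih ih' =>
    obtain ⟨c, hc⟩ := ih
    obtain ⟨c', hc'⟩ := ih'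
    refine ⟨c * c', ?_⟩
    rw [← wordWeight_perm h] at hc'
    have := Submodule.add_mem _ hc (Submodule.smul_mem _ c hc')
    rwa [smul_sub, smul_smul, sub_add_sub_cancel] at this

theorem sum_mul_perm_lt {t : ℕ} {f g : Fin t → ℕ} (hf : StrictMono f) (hg : StrictMono g)
    {σ : Equiv.Perm (Fin t)} (hσ : σ ≠ 1) : ∑ a, f a * g (σ a) < ∑ a, f a * g a := by
  rw [(hf.monotone.monovary hg.monotone).sum_mul_comp_perm_lt_sum_mul_iff]
  intro hm
  apply hσ
  have hmono : StrictMono (σ⁻¹ : Equiv.Perm (Fin t)) := by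
    refine Monotone.strictMono_of_injective (fun x y hxy => ?_) σ⁻¹.injective
    rcases hxy.eq_or_lt with rfl | hxy
    · exact le_rfl
    · refine hf.le_iff_le.mp (hm ?_)
      simpa using hg hxy
  have h1 : ⇑σ⁻¹ = id := by
    have := Subsingleton.elim (hmono.orderIsoOfSurjective _ σ⁻¹.surjective) (OrderIso.refl _)
    funext x
    exact congrArg (fun e : Fin t ≃o Fin t => e x) this
  rw [← inv_eq_one]
  ext x
  simp [h1]

theorem wordWeight_ofFn {t : ℕ} (ro co : Fin t → Fin n) :
    wordWeight (List.ofFn fun a => (ro a, co a)) = ∑ a, (ro a).val * (co a).val := by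
  simp [wordWeight, List.map_ofFn, List.sum_ofFn, Function.comp_def]

/-- If a quantum minor vanishes, its diagonal is a combination of words of lower weight. -/
theorem wordProd_diagonal_mem_lowSpan {t : ℕ} {ro co : Fin t → Fin n} (hro : StrictMono ro)
    (hco : StrictMono co) (h : rowMinor q X ro co = 0) :
    wordProd X (List.ofFn fun a => (ro a, co a)) ∈
      lowSpan k X (wordWeight (List.ofFn fun a => (ro a, co a))) := by
  unfold rowMinor at h
  have e : ∀ σ : Equiv.Perm (Fin t), (List.ofFn fun a => X (ro a) (co (σ a))).prod =
      wordProd X (List.ofFn fun a => (ro a, co (σ a))) := by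
    intro σ; simp [wordProd, List.map_ofFn, Function.comp_def]
  rw [← Finset.add_sum_erase _ _ (Finset.mem_univ (1 : Equiv.Perm (Fin t))), invCount_one,
    pow_zero, one_smul, e] at h
  have h2 := eq_neg_of_add_eq_zero_left h
  simp only [Equiv.Perm.coe_one, id_eq] at h2
  rw [h2]
  refine Submodule.neg_mem _ (Submodule.sum_mem _ fun σ hσ => Submodule.smul_mem _ _ ?_)
  rw [e]
  refine wordProd_mem_lowSpan ?_
  rw [wordWeight_ofFn ro, wordWeight_ofFn ro]
  exact sum_mul_perm_lt (f := fun a => (ro a).val) (g := fun a => (co a).val)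
    (fun _ _ h => hro h) (fun _ _ h => hco h) (Finset.ne_of_mem_erase hσ)

/-- A multiset of cells containing no south-east chain of length `t`. -/
def ChainFree (t : ℕ) (μ : Multiset (Fin n × Fin n)) : Prop :=
  ¬ ∃ ro co : Fin t → Fin n, StrictMono ro ∧ StrictMono co ∧ ∀ a, (ro a, co a) ∈ μ

theorem wordProd_mem_span_chainFree (hq : q ≠ 0) (hX : IsQMat q X) {t : ℕ}
    (hminor : ∀ ro co : Fin t → Fin n, StrictMono ro → StrictMono co → rowMinor q X ro co = 0)
    (w : List (Fin n × Fin n)) :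
    wordProd X w ∈ Submodule.span k ((fun μ => wordProd X μ.toList) '' {μ | ChainFree t μ}) := by
  induction hN : wordWeight w using Nat.strong_induction_on generalizing w with
  | _ N ih =>
  have hlow : lowSpan k X N ≤
      Submodule.span k ((fun μ => wordProd X μ.toList) '' {μ | ChainFree t μ}) := by
    refine Submodule.span_le.mpr ?_
    rintro _ ⟨u, hu, rfl⟩
    exact ih _ hu u rfl
  by_cases hw : ChainFree t (w : Multiset (Fin n × Fin n))
  · obtain ⟨c, hc⟩ := hX.exists_perm hq (w := w) (w' := (w : Multiset (Fin n × Fin n)).toList)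
      (Multiset.coe_eq_coe.mp (Multiset.coe_toList _).symm)
    rw [← sub_add_cancel (wordProd X w) (c • wordProd X (w : Multiset (Fin n × Fin n)).toList)]
    exact Submodule.add_mem _ (hlow (hN ▸ hc))
      (Submodule.smul_mem _ _ (Submodule.subset_span ⟨_, hw, rfl⟩))
  · obtain ⟨ro, co, hro, hco, hmem⟩ := not_not.mp hw
    have hnd : (List.ofFn fun a => (ro a, co a)).Nodup :=
      List.nodup_ofFn.mpr fun a b h => hro.injective (Prod.ext_iff.mp h).1
    have hsub : (List.ofFn fun a => (ro a, co a)).Subperm w := by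
      refine List.subperm_of_subset hnd fun x hx => ?_
      obtain ⟨a, rfl⟩ := List.mem_ofFn.mp hx
      exact Multiset.mem_coe.mp (hmem a)
    obtain ⟨u, hu⟩ := Multiset.le_iff_exists_add.mp (Multiset.coe_le.mpr hsub)
    rw [← Multiset.coe_toList u, Multiset.coe_add, Multiset.coe_eq_coe] at hu
    obtain ⟨c, hc⟩ := hX.exists_perm hq hu
    have h2 := mul_wordProd_mem_lowSpan
      (wordProd_diagonal_mem_lowSpan hro hco (hminor ro co hro hco)) u.toList
    rw [← wordProd_append, ← wordWeight_append, ← wordWeight_perm hu] at h2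
    have := Submodule.add_mem _ hc (Submodule.smul_mem _ c h2)
    rw [sub_add_cancel, hN] at this
    exact hlow this

theorem span_chainFree_eq_top (hq : q ≠ 0) (hX : IsQMat q X)
    (hgen : Algebra.adjoin k (Set.range fun p : Fin n × Fin n => X p.1 p.2) = ⊤) {t : ℕ}
    (hminor : ∀ ro co : Fin t → Fin n, StrictMono ro → StrictMono co → rowMinor q X ro co = 0) :
    Submodule.span k ((fun μ => wordProd X μ.toList) '' {μ | ChainFree t μ}) = ⊤ := by
  rw [eq_top_iff, ← Algebra.top_toSubmodule, ← hgen, Algebra.adjoin_eq_span, Submodule.span_le]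
  intro x hx
  obtain ⟨l, hl, rfl⟩ := Submonoid.exists_list_of_mem_closure hx
  obtain ⟨w, rfl⟩ : l ∈ Set.range (List.map fun p : Fin n × Fin n => X p.1 p.2) := by
    rw [Set.range_list_map]
    exact hl
  exact wordProd_mem_span_chainFree hq hX hminor w

end Spanning

section Faithfulness

variable {k : Type} [Field k] {q : k} {n r : ℕ} {F : ℕ → ℕ → Prop}

theorem repMat_mem_filt_cellWeight (hrn : r ≤ n) (hq : q ≠ 0) (p : Fin n × Fin n) :
    repMat q hrn p.1 p.2 ∈ filt q (cellWeight n r F) ((p.1.val * p.2.val : ℕ) : ℤ) :=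
  repMat_mem_filt hrn hq levelStrict_cellWeight_zero levelStrict_cellWeight_one
    fun _ _ h1 h2 => by
      push_cast; exact cellWeight_entryExp_le h1 h2 p.1.isLt p.2.isLt

theorem repMat_mem_filt_cellWeight_of_not_tight (hrn : r ≤ n) (hq : q ≠ 0) {p : Fin n × Fin n}
    (hp : ¬ ∃ l, Tight (cellWeight n r F) r l p.1 p.2) :
    repMat q hrn p.1 p.2 ∈ filt q (cellWeight n r F) (((p.1.val * p.2.val : ℕ) : ℤ) - 1) := by
  refine repMat_mem_filt hrn hq levelStrict_cellWeight_zero levelStrict_cellWeight_one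
    fun l hl h1 h2 => ?_
  have h3 := cellWeight_entryExp_le (F := F) (r := r) h1 h2 p.1.isLt p.2.isLt
  have h4 : cellWeight n r F (entryExp l p.1 p.2) ≠ p.1.val * p.2.val :=
    fun h => hp ⟨l, hl, h1, h2, h⟩
  push_cast
  omega

theorem map_cellExp {ω : Expo →+ ℤ} {p : Fin n × Fin n} (hp : ∃ l, Tight ω r l p.1 p.2) :
    ω (cellExp ω r p) = ((p.1.val * p.2.val : ℕ) : ℤ) := by
  push_cast; exact (tight_cellLevel hp).2.2.2

theorem isLead_repMat_of_tight (hrn : r ≤ n) (hq : q ≠ 0) {p : Fin n × Fin n}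
    (hp : ∃ l, Tight (cellWeight n r F) r l p.1 p.2) :
    IsLead q (cellWeight n r F) (cellExp (cellWeight n r F) r p) (repMat q hrn p.1 p.2) := by
  have ht := tight_cellLevel hp
  refine isLead_repMat hrn hq levelStrict_cellWeight_zero levelStrict_cellWeight_one
    ht.1 ht.2.1 ht.2.2.1 fun l hl h1 h2 hne => ?_
  rw [ht.2.2.2]
  refine lt_of_le_of_ne (cellWeight_entryExp_le h1 h2 p.1.isLt p.2.isLt) fun h => hne ?_
  exact Tight.level_unique p.1.isLt p.2.isLt ⟨hl, h1, h2, h⟩ ht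

theorem wordProd_repMat_mem_filt (hrn : r ≤ n) (hq : q ≠ 0) (w : List (Fin n × Fin n)) :
    wordProd (repMat q hrn) w ∈ filt q (cellWeight n r F) (wordWeight w) := by
  induction w with
  | nil => simpa [wordProd, wordWeight] using (isLead_one (q := q) (ω := cellWeight n r F)).mem
  | cons p w ih =>
    have := mul_mem_filt hq (repMat_mem_filt_cellWeight (F := F) hrn hq p) ih
    simpa [wordProd, wordWeight] using this

theorem wordProd_repMat_mem_filt_of_not_tight (hrn : r ≤ n) (hq : q ≠ 0)
    {w : List (Fin n × Fin n)} {p : Fin n × Fin n} (hpw : p ∈ w)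
    (hp : ¬ ∃ l, Tight (cellWeight n r F) r l p.1 p.2) :
    wordProd (repMat q hrn) w ∈ filt q (cellWeight n r F) (wordWeight w - 1) := by
  obtain ⟨u, v, rfl⟩ := List.append_of_mem hpw
  have h1 := mul_mem_filt hq (wordProd_repMat_mem_filt (F := F) hrn hq u)
    (mul_mem_filt hq (repMat_mem_filt_cellWeight_of_not_tight hrn hq hp)
      (wordProd_repMat_mem_filt hrn hq v))
  rw [wordProd_append]
  refine filt_mono (le_of_eq ?_) (show _ ∈ _ by simpa only [wordProd, List.map_cons,
    List.prod_cons] using h1)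
  simp only [wordWeight, List.map_append, List.map_cons, List.sum_append, List.sum_cons]
  push_cast
  ring

theorem isLead_wordProd_repMat (hrn : r ≤ n) (hq : q ≠ 0) {w : List (Fin n × Fin n)}
    (hw : ∀ p ∈ w, ∃ l, Tight (cellWeight n r F) r l p.1 p.2) :
    IsLead q (cellWeight n r F) (w.map (cellExp (cellWeight n r F) r)).sum
      (wordProd (repMat q hrn) w) := by
  induction w with
  | nil => simpa [wordProd] using isLead_one
  | cons p w ih =>
    have := (isLead_repMat_of_tight hrn hq (hw p List.mem_cons_self)).mul hq
      (ih fun p hp => hw p (List.mem_cons_of_mem _ hp))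
    simpa [wordProd] using this

theorem map_sum_cellExp {ω : Expo →+ ℤ} {w : List (Fin n × Fin n)}
    (hw : ∀ p ∈ w, ∃ l, Tight ω r l p.1 p.2) :
    ω (w.map (cellExp ω r)).sum = wordWeight w := by
  induction w with
  | nil => simp [wordWeight]
  | cons p w ih =>
    have := ih fun p hp => hw p (List.mem_cons_of_mem _ hp)
    rw [List.map_cons, List.sum_cons, map_add, this, map_cellExp (hw p List.mem_cons_self)]
    simp [wordWeight]

/-- The cells of a chain-free multiset are tight for the weight it determines. -/
theorem ChainFree.exists_tight {μ : Multiset (Fin n × Fin n)} (hμ : ChainFree (r + 1) μ)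
    {p : Fin n × Fin n} (hp : p ∈ μ) :
    ∃ l, Tight (cellWeight n r fun i j => ∃ p ∈ μ, p.1.val = i ∧ p.2.val = j) r l p.1 p.2 := by
  refine _root_.exists_tight p.1.isLt p.2.isLt ⟨p, hp, rfl, rfl⟩ ?_
  rintro ⟨ro, co, hmono, hmem, -, -⟩
  have : Nonempty (Fin n × Fin n) := ⟨p⟩
  choose! f hf using hmem
  refine hμ ⟨fun a => (f a).1, fun a => (f a).2, fun a b hab => ?_, fun a b hab => ?_,
    fun a => (hf a (Nat.lt_succ_iff.mp a.isLt)).1⟩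
  all_goals
    have h1 := (hf a (Nat.lt_succ_iff.mp a.isLt)).2
    have h2 := (hf b (Nat.lt_succ_iff.mp b.isLt)).2
    have h3 := hmono a b hab (Nat.lt_succ_iff.mp b.isLt)
    simp only [Fin.lt_def]
    omega

/-- An algebra spanned by chain-free words embeds into the operators generated by `repMat`. -/
theorem injective_of_map_eq_repMat (hrn : r ≤ n) (hq : q ≠ 0) {A : Type} [Ring A] [Algebra k A]
    {X : Fin n → Fin n → A} (Ψ : A →ₐ[k] Module.End k (Expo →₀ k))
    (hΨ : ∀ i j, Ψ (X i j) = repMat q hrn i j)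
    (hspan : Submodule.span k ((fun μ => wordProd X μ.toList) '' {μ | ChainFree (r + 1) μ}) = ⊤) :
    Function.Injective Ψ := by
  have hword : ∀ w, Ψ (wordProd X w) = wordProd (repMat q hrn) w := by
    intro w
    simp [wordProd, map_list_prod, Function.comp_def, hΨ]
  rw [injective_iff_map_eq_zero]
  intro x hx
  obtain ⟨c, hc, rfl⟩ := (Finsupp.mem_span_image_iff_linearCombination k).mp
    (hspan ▸ Submodule.mem_top : x ∈ _)
  by_contra hne
  have hsupp : c.support.Nonempty := by
    rw [Finsupp.support_nonempty_iff]
    rintro rfl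
    exact hne (map_zero _)
  obtain ⟨ν, hν, hmax⟩ := Finset.exists_max_image c.support
    (fun μ => wordWeight μ.toList) hsupp
  have hνfree : ChainFree (r + 1) ν := hc hν
  set F : ℕ → ℕ → Prop := fun i j => ∃ p ∈ ν, p.1.val = i ∧ p.2.val = j
  set ω := cellWeight n r F with hω
  have hνt : ∀ p ∈ ν.toList, ∃ l, Tight ω r l p.1 p.2 :=
    fun p hp => hνfree.exists_tight (Multiset.mem_toList.mp hp)
  set V : Expo := (ν.toList.map (cellExp ω r)).sum with hV
  have hωV : ω V = wordWeight ν.toList := map_sum_cellExp hνt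
  have hzero : ∀ μ ∈ c.support, μ ≠ ν →
      wordProd (repMat q hrn) μ.toList (Finsupp.single 0 1) V = 0 := by
    intro μ hμ hμν
    have hle := hmax μ hμ
    rcases hle.lt_or_eq with hlt | heq
    · refine filt_apply_eq_zero (wordProd_repMat_mem_filt (F := F) hrn hq _) ?_
      rw [← hω, hωV]
      exact_mod_cast hlt
    by_cases ht : ∀ p ∈ μ.toList, ∃ l, Tight ω r l p.1 p.2
    · refine (isLead_wordProd_repMat hrn hq ht).apply_eq_zero ?_ fun h => hμν ?_
      · rw [← hω, hωV, map_sum_cellExp ht, heq]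
      · refine multiset_eq_of_sum_cellExp_eq (r := r) (F := F)
          (fun p hp => ht p (Multiset.mem_toList.mpr hp))
          (fun p hp => hνt p (Multiset.mem_toList.mpr hp)) ?_
        rw [← Multiset.coe_toList μ, ← Multiset.coe_toList ν, Multiset.map_coe, Multiset.map_coe,
          Multiset.sum_coe, Multiset.sum_coe]
        exact h
    · push Not at ht
      obtain ⟨p, hp, hpt⟩ := ht
      refine filt_apply_eq_zero (wordProd_repMat_mem_filt_of_not_tight (F := F) hrn hq hp
        (fun ⟨l, hl⟩ => hpt l hl)) ?_
      rw [← hω, hωV]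
      have : wordWeight μ.toList = wordWeight ν.toList := heq
      omega
  have h0 := congrArg (fun T : Module.End k (Expo →₀ k) => T (Finsupp.single 0 1) V) hx
  simp only [Finsupp.linearCombination_apply, Finsupp.sum, map_sum, map_smul, hword,
    LinearMap.sum_apply, LinearMap.smul_apply, Finsupp.finsetSum_apply, Finsupp.smul_apply,
    LinearMap.zero_apply, Finsupp.zero_apply] at h0
  rw [Finset.sum_eq_single ν (fun μ hμ hne => by rw [hzero μ hμ hne, smul_zero])
    (fun h => absurd hν h)] at h0
  exact smul_ne_zero (Finsupp.mem_support_iff.mp hν)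
    (isLead_wordProd_repMat hrn hq hνt).apply_ne_zero h0

end Faithfulness

section RankAlgebra

variable {k : Type} [Field k] {q : k}

theorem isQMat_zgen (n r : ℕ) : IsQMat q (Zgen k q n r) where
  row i j l h := by
    simpa [Zgen] using RingQuot.mkAlgHom_rel k (QMatRel.row (q := q) i j l h)
  col i s j h := by
    simpa [Zgen] using RingQuot.mkAlgHom_rel k (QMatRel.col (q := q) i s j h)
  cross i s j l h h' := by
    simpa [Zgen] using RingQuot.mkAlgHom_rel k (QMatRel.cross (q := q) i s j l h h')
  diag i s j l h h' := by
    simpa [Zgen] using RingQuot.mkAlgHom_rel k (QMatRel.diag (q := q) i s j l h h')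

theorem adjoin_zgen (n r : ℕ) :
    Algebra.adjoin k (Set.range fun p : Fin n × Fin r => Zgen k q n r p.1 p.2) = ⊤ := by
  have h : (Set.range fun p : Fin n × Fin r => Zgen k q n r p.1 p.2) =
      RingQuot.mkAlgHom k (QMatRel k q n r) '' Set.range (FreeAlgebra.ι k) := by
    rw [← Set.range_comp]; rfl
  rw [h, Algebra.adjoin_image, FreeAlgebra.adjoin_range_ι, Algebra.map_top, AlgHom.range_eq_top]
  exact RingQuot.mkAlgHom_surjective k _

section

variable {A B : Type} [Ring A] [Algebra k A] [Ring B] [Algebra k B]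

theorem IsQMat.map {ι κ : Type} [LinearOrder ι] [LinearOrder κ] {Z : ι → κ → A} (h : IsQMat q Z)
    (f : A →ₐ[k] B) : IsQMat q fun i j => f (Z i j) where
  row i j l hl := by simpa using congrArg f (h.row i j l hl)
  col i s j hs := by simpa using congrArg f (h.col i s j hs)
  cross i s j l h1 h2 := by simpa using congrArg f (h.cross i s j l h1 h2)
  diag i s j l h1 h2 := by simpa using congrArg f (h.diag i s j l h1 h2)

theorem map_rowMinor {ι κ : Type} {t : ℕ} (f : A →ₐ[k] B) (Z : ι → κ → A) (ro : Fin t → ι)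
    (co : Fin t → κ) : f (rowMinor q Z ro co) = rowMinor q (fun i j => f (Z i j)) ro co := by
  simp [rowMinor, map_list_prod, List.map_ofFn, Function.comp_def]

/-- The algebra map out of `M_q(n,r)` determined by a quantum matrix. -/
noncomputable def liftQMat {n r : ℕ} (Z : Fin n → Fin r → B) (hZ : IsQMat q Z) :
    QMat k q n r →ₐ[k] B :=
  RingQuot.liftAlgHom k ⟨FreeAlgebra.lift k fun p : Fin n × Fin r => Z p.1 p.2, by
    intro x y h
    cases h with
    | row i j l h => simpa using hZ.row i j l h
    | col i s j h => simpa using hZ.col i s j h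
    | cross i s j l h h' => simpa using hZ.cross i s j l h h'
    | diag i s j l h h' => simpa using hZ.diag i s j l h h'⟩

theorem liftQMat_zgen {n r : ℕ} (Z : Fin n → Fin r → B) (hZ : IsQMat q Z) (i : Fin n)
    (j : Fin r) : liftQMat Z hZ (Zgen k q n r i j) = Z i j := by
  simp [liftQMat, Zgen]

theorem exists_mul_eq_mul_of_adjoin_eq_top {s : Set A} (hs : Algebra.adjoin k s = ⊤) {d : A}
    (h : ∀ x ∈ s, ∃ b, d * x = b * d) (a : A) : ∃ b, d * a = b * d := by
  induction (hs ▸ Algebra.mem_top : a ∈ Algebra.adjoin k s) using Algebra.adjoin_induction with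
  | mem x hx => exact h x hx
  | algebraMap c => exact ⟨algebraMap k A c, (Algebra.commutes c d).symm⟩
  | add x y _ _ hx hy =>
    obtain ⟨b, hb⟩ := hx
    obtain ⟨b', hb'⟩ := hy
    exact ⟨b + b', by rw [mul_add, hb, hb', add_mul]⟩
  | mul x y _ _ hx hy =>
    obtain ⟨b, hb⟩ := hx
    obtain ⟨b', hb'⟩ := hy
    exact ⟨b * b', by rw [← mul_assoc, hb, mul_assoc, hb', mul_assoc]⟩

theorem exists_mul_eq_mul_of_adjoin_eq_top' {s : Set A} (hs : Algebra.adjoin k s = ⊤) {d : A}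
    (h : ∀ x ∈ s, ∃ b, x * d = d * b) (a : A) : ∃ b, a * d = d * b := by
  induction (hs ▸ Algebra.mem_top : a ∈ Algebra.adjoin k s) using Algebra.adjoin_induction with
  | mem x hx => exact h x hx
  | algebraMap c => exact ⟨algebraMap k A c, Algebra.commutes c d⟩
  | add x y _ _ hx hy =>
    obtain ⟨b, hb⟩ := hx
    obtain ⟨b', hb'⟩ := hy
    exact ⟨b + b', by rw [add_mul, hb, hb', mul_add]⟩
  | mul x y _ _ hx hy =>
    obtain ⟨b, hb⟩ := hx
    obtain ⟨b', hb'⟩ := hy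
    exact ⟨b * b', by rw [mul_assoc, hb', ← mul_assoc, hb, mul_assoc]⟩

theorem exists_smul_pow_mul {d : A} (h : ∀ a, ∃ b, d * a = b * d) (c : k) (m : ℕ) (a : A) :
    ∃ b, (c • d ^ m) * a = b * (c • d ^ m) := by
  have : ∃ b, d ^ m * a = b * d ^ m := by
    induction m generalizing a with
    | zero => exact ⟨a, by simp⟩
    | succ m ih =>
      obtain ⟨b, hb⟩ := h a
      obtain ⟨b', hb'⟩ := ih b
      exact ⟨b', by rw [pow_succ, mul_assoc, hb, ← mul_assoc, hb', mul_assoc]⟩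
  obtain ⟨b, hb⟩ := this
  exact ⟨b, by rw [smul_mul_assoc, hb, mul_smul_comm]⟩

theorem exists_mul_smul_pow {d : A} (h : ∀ a, ∃ b, a * d = d * b) (c : k) (m : ℕ) (a : A) :
    ∃ b, a * (c • d ^ m) = (c • d ^ m) * b := by
  have : ∃ b, a * d ^ m = d ^ m * b := by
    induction m generalizing a with
    | zero => exact ⟨a, by simp⟩
    | succ m ih =>
      obtain ⟨b, hb⟩ := h a
      obtain ⟨b', hb'⟩ := ih b
      exact ⟨b', by rw [pow_succ', ← mul_assoc, hb, mul_assoc, hb', mul_assoc]⟩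
  obtain ⟨b, hb⟩ := this
  exact ⟨b, by rw [mul_smul_comm, hb, smul_mul_assoc]⟩

theorem isRegular_of_map_isUnit {f : A →ₐ[k] B} (hf : Function.Injective f) {x : A}
    (hx : IsUnit (f x)) : IsRegular x := by
  refine ⟨fun a b h => hf (hx.mul_left_cancel ?_), fun a b h => hf (hx.mul_right_cancel ?_)⟩
  · simpa using congrArg f h
  · simpa using congrArg f h

end

variable {n r : ℕ}

theorem adjoin_rankProj_zgen :
    Algebra.adjoin k (Set.range fun p : Fin n × Fin n =>
      rankProj k q n r (Zgen k q n n p.1 p.2)) = ⊤ := by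
  have h : (Set.range fun p : Fin n × Fin n => rankProj k q n r (Zgen k q n n p.1 p.2)) =
      rankProj k q n r '' Set.range fun p : Fin n × Fin n => Zgen k q n n p.1 p.2 := by
    rw [← Set.range_comp]; rfl
  rw [h, Algebra.adjoin_image, adjoin_zgen, Algebra.map_top, AlgHom.range_eq_top]
  exact RingQuot.mkAlgHom_surjective k _

theorem rowMinor_rankProj_zgen {ro co : Fin (r + 1) → Fin n} (hro : StrictMono ro)
    (hco : StrictMono co) :
    rowMinor q (fun i j => rankProj k q n r (Zgen k q n n i j)) ro co = 0 := by
  rw [← map_rowMinor]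
  have h : minorRel k q n (r + 1) (qMinor k q n n (r + 1) ro co) 0 :=
    ⟨⟨ro, co, hro, hco, rfl⟩, rfl⟩
  exact (RingQuot.mkAlgHom_rel k h).trans (map_zero _)

/-- The representation of the rank `r` quotient by the operators `repMat`. -/
noncomputable def rankRep (hrn : r ≤ n) (hq : q ≠ 0) :
    QMatRank k q n r →ₐ[k] Module.End k (Expo →₀ k) :=
  RingQuot.liftAlgHom k ⟨liftQMat (repMat q hrn) (repMat_isQMat hrn hq), by
    rintro x y ⟨⟨ro, co, -, hco, rfl⟩, rfl⟩
    have h := map_rowMinor (q := q) (liftQMat (repMat q hrn) (repMat_isQMat hrn hq))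
      (Zgen k q n n) ro co
    simp only [liftQMat_zgen] at h
    rw [map_zero, ← rowMinor_repMat_eq_zero hrn hq ro hco]
    exact h⟩

theorem rankRep_zgen (hrn : r ≤ n) (hq : q ≠ 0) (i j : Fin n) :
    rankRep hrn hq (rankProj k q n r (Zgen k q n n i j)) = repMat q hrn i j := by
  simp [rankRep, rankProj, liftQMat_zgen]

theorem rankRep_dMinor (hrn : r ≤ n) (hq : q ≠ 0) :
    rankRep hrn hq (rankProj k q n r (dMinor k q n r hrn)) =
      rowMinor q (repMat q hrn) (Fin.castLE hrn) (Fin.castLE hrn) := by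
  have h1 := map_rowMinor (q := q) (B := QMatRank k q n r) (rankProj k q n r) (Zgen k q n n) (Fin.castLE hrn)
    (Fin.castLE hrn)
  have h2 := map_rowMinor (q := q) (B := Module.End k (Expo →₀ k)) (rankRep hrn hq)
    (fun i j => rankProj k q n r (Zgen k q n n i j)) (Fin.castLE hrn) (Fin.castLE hrn)
  simp only [rankRep_zgen] at h2
  rw [← h2, ← h1]
  rfl

theorem rankRep_injective (hrn : r ≤ n) (hq : q ≠ 0) :
    Function.Injective (rankRep (q := q) hrn hq) := by
  have h := span_chainFree_eq_top (q := q) hq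
    (X := fun i j => rankProj k q n r (Zgen k q n n i j))
    ((isQMat_zgen n n).map (B := QMatRank k q n r) (rankProj k q n r)) adjoin_rankProj_zgen
    (t := r + 1) fun _ _ => rowMinor_rankProj_zgen
  exact injective_of_map_eq_repMat (A := QMatRank k q n r)
    (X := fun i j => rankProj k q n r (Zgen k q n n i j)) hrn hq (rankRep hrn hq)
    (rankRep_zgen hrn hq) h

theorem dMinor_mul_zgen (hrn : r ≤ n) (hq : q ≠ 0) (i j : Fin n) :
    rankProj k q n r (dMinor k q n r hrn) * rankProj k q n r (Zgen k q n n i j) =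
      ((if i.val < r then 1 else q) * (if j.val < r then 1 else q)) •
        (rankProj k q n r (Zgen k q n n i j) * rankProj k q n r (dMinor k q n r hrn)) := by
  apply rankRep_injective hrn hq
  rw [map_smul, map_mul, map_mul, rankRep_zgen, rankRep_dMinor]
  exact leading_mul_repMat hrn hq i j

end RankAlgebra

/-- For `1 ≤ r ≤ n - 1` and `S = {q^{-i} d^j}`, the image `π(S)`
of `S` under the quotient map `π : M_q(n) → M^{r+1}_q(n)` is a multiplicatively closed
set of regular elements satisfying the left and right Ore conditions in `M^{r+1}_q(n)`. -/
theorem rankProj_powerSet_ore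
    (k : Type) [Field k] (q : k) (hq0 : q ≠ 0) (n r : ℕ) (hr : 1 ≤ r)
    (hrn : r + 1 ≤ n) :
    (∀ x ∈ rankProj k q n r '' powerSet k q n r (le_of_lt hrn), IsRegular x) ∧
    (∀ x ∈ rankProj k q n r '' powerSet k q n r (le_of_lt hrn),
      ∀ y ∈ rankProj k q n r '' powerSet k q n r (le_of_lt hrn),
        x * y ∈ rankProj k q n r '' powerSet k q n r (le_of_lt hrn)) ∧
    (∀ a : QMatRank k q n r,
      ∀ s ∈ rankProj k q n r '' powerSet k q n r (le_of_lt hrn),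
        ∃ b : QMatRank k q n r,
          ∃ t ∈ rankProj k q n r '' powerSet k q n r (le_of_lt hrn), t * a = b * s) ∧
    (∀ a : QMatRank k q n r,
      ∀ s ∈ rankProj k q n r '' powerSet k q n r (le_of_lt hrn),
        ∃ b : QMatRank k q n r,
          ∃ t ∈ rankProj k q n r '' powerSet k q n r (le_of_lt hrn), a * t = s * b) := by
  have hrn' : r ≤ n := le_of_lt hrn
  have hc : ∀ i j : Fin n, ((if i.val < r then 1 else q) * (if j.val < r then 1 else q)) ≠ 0 := by
    intro i j
    split_ifs <;> simp [hq0]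
  have hleft : ∀ a, ∃ b, rankProj k q n r (dMinor k q n r hrn') * a =
      b * rankProj k q n r (dMinor k q n r hrn') := by
    refine exists_mul_eq_mul_of_adjoin_eq_top (A := QMatRank k q n r)
      (adjoin_rankProj_zgen (q := q) (n := n) (r := r)) ?_
    rintro _ ⟨⟨i, j⟩, rfl⟩
    exact ⟨_, (dMinor_mul_zgen hrn' hq0 i j).trans (smul_mul_assoc _ _ _).symm⟩
  have hright : ∀ a, ∃ b, a * rankProj k q n r (dMinor k q n r hrn') =
      rankProj k q n r (dMinor k q n r hrn') * b := by
    refine exists_mul_eq_mul_of_adjoin_eq_top' (A := QMatRank k q n r)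
      (adjoin_rankProj_zgen (q := q) (n := n) (r := r)) ?_
    rintro _ ⟨⟨i, j⟩, rfl⟩
    refine ⟨((if i.val < r then 1 else q) * (if j.val < r then 1 else q))⁻¹ •
      rankProj k q n r (Zgen k q n n i j), ?_⟩
    rw [mul_smul_comm, dMinor_mul_zgen hrn' hq0 i j, smul_smul, inv_mul_cancel₀ (hc i j), one_smul]
  refine ⟨?_, ?_, ?_, ?_⟩
  · rintro _ ⟨_, ⟨i, j, rfl⟩, rfl⟩
    refine isRegular_of_map_isUnit (A := QMatRank k q n r)
      (B := Module.End k (Expo →₀ k)) (f := rankRep hrn' hq0) (rankRep_injective hrn' hq0) ?_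
    rw [map_smul, map_smul, map_pow, map_pow, rankRep_dMinor, Algebra.smul_def]
    exact ((((isUnit_iff_ne_zero.mpr hq0).inv).pow i).map _).mul
      ((isUnit_rowMinor_repMat_leading hrn' hq0).pow j)
  · rintro _ ⟨_, ⟨i, j, rfl⟩, rfl⟩ _ ⟨_, ⟨i', j', rfl⟩, rfl⟩
    refine ⟨_, ⟨i + i', j + j', rfl⟩, ?_⟩
    rw [← map_mul, smul_mul_smul_comm, pow_add, pow_add]
  · rintro a _ ⟨_, ⟨i, j, rfl⟩, rfl⟩
    obtain ⟨b, hb⟩ := exists_smul_pow_mul hleft (q⁻¹ ^ i) j a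
    refine ⟨b, _, ⟨_, ⟨i, j, rfl⟩, rfl⟩, ?_⟩
    rw [map_smul, map_pow]
    exact hb
  · rintro a _ ⟨_, ⟨i, j, rfl⟩, rfl⟩
    obtain ⟨b, hb⟩ := exists_mul_smul_pow hright (q⁻¹ ^ i) j a
    refine ⟨b, _, ⟨_, ⟨i, j, rfl⟩, rfl⟩, ?_⟩
    rw [map_smul, map_pow]
    exact hb
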